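/- arXiv:2111.04690 — 9 statements merged into one kernel-verified Lean document; each statement's English description precedes it below -/
import Mathlib

section
/- Let (F,g) be a one-dimensional figure with weights, let A ⊆ ℂ be a finite set, and let w : ℤ → ℂ be a function whose range is contained in A. If there exists a constant C ∈ ℂ such that ∑_{x ∈ F} w(x+t)·g(x) = C for every t ∈ ℤ, then w is periodic. -/
/-- A weighted sum that is invariant under shifting `t` by `p`, all of whose terms other than the
one at `y` are invariant, has an invariant term at `y`. -/
theorem eq_of_shift_sum_eq {F : Finset ℤ} {g : ℤ → ℤ} {w : ℤ → ℂ} {C : ℂ}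
    (hsum : ∀ t : ℤ, ∑ x ∈ F, w (x + t) * (g x : ℂ) = C) {p t y : ℤ} (hy : y ∈ F)
    (hgy : g y ≠ 0) (h : ∀ x ∈ F, x ≠ y → w (x + t + p) = w (x + t)) :
    w (y + t + p) = w (y + t) := by
  have hdiff : ∑ x ∈ F, (w (x + t + p) - w (x + t)) * (g x : ℂ) = 0 := by
    simp only [sub_mul, Finset.sum_sub_distrib, add_assoc]
    rw [hsum, hsum, sub_self]
  rw [Finset.sum_eq_single_of_mem y hy fun x hx hxy => by rw [h x hx hxy, sub_self, zero_mul]]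
    at hdiff
  exact sub_eq_zero.mp ((mul_eq_zero.mp hdiff).resolve_right (Int.cast_ne_zero.mpr hgy))

/-- Two windows of the same length `n` of a function with finite range agree. -/
theorem exists_window_eq {A : Finset ℂ} {w : ℤ → ℂ} (hwA : ∀ i : ℤ, w i ∈ A) (n : ℕ) :
    ∃ a p : ℤ, 0 < p ∧ ∀ k : ℕ, k < n → w (a + k + p) = w (a + k) := by
  obtain ⟨a, b, hab, heq⟩ := Finite.exists_ne_map_eq_of_infinite
    (fun (t : ℤ) (k : Fin n) => (⟨w (t + (k : ℕ)), hwA _⟩ : A))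
  have hval (k : ℕ) (hk : k < n) : w (a + k) = w (b + k) :=
    congrArg Subtype.val (congrFun heq ⟨k, hk⟩)
  rcases lt_or_gt_of_ne hab with hlt | hlt
  · refine ⟨a, b - a, sub_pos.mpr hlt, fun k hk => ?_⟩
    rw [hval k hk]
    congr 1
    ring
  · refine ⟨b, a - b, sub_pos.mpr hlt, fun k hk => ?_⟩
    rw [← hval k hk]
    congr 1
    ring

/-- Let (F,g) be a one-dimensional figure with weights, let A ⊆ ℂ be a finite
set, and let w : ℤ → ℂ be a function whose range is contained in A. If there exists a
constant C ∈ ℂ such that ∑_{x ∈ F} w(x+t)·g(x) = C for every t ∈ ℤ, then w is periodic. -/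
theorem stmt0 (F : Finset ℤ) (hF : F.Nonempty) (g : ℤ → ℤ)
    (hg : ∀ x : ℤ, x ∈ F ↔ g x ≠ 0)
    (A : Finset ℂ) (w : ℤ → ℂ) (hwA : ∀ i : ℤ, w i ∈ A)
    (C : ℂ) (hsum : ∀ t : ℤ, ∑ x ∈ F, w (x + t) * (g x : ℂ) = C) :
    ∃ p : ℤ, 0 < p ∧ ∀ i : ℤ, w (i + p) = w i := by
  have hgF {x : ℤ} (hx : x ∈ F) : g x ≠ 0 := (hg x).mp hx
  set m := F.min' hF
  set M := F.max' hF
  have hm : m ∈ F := F.min'_mem hF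
  have hM : M ∈ F := F.max'_mem hF
  have hle (x : ℤ) (hx : x ∈ F) : m ≤ x ∧ x ≤ M := ⟨F.min'_le x hx, F.le_max' x hx⟩
  obtain ⟨a, p, hp, hap⟩ := exists_window_eq hwA (M - m).toNat
  have hnext (t : ℤ) (ht : ∀ x, m ≤ x → x < M → w (x + t + p) = w (x + t)) :
      w (M + t + p) = w (M + t) :=
    eq_of_shift_sum_eq hsum hM (hgF hM) fun x hx hne =>
      ht x (hle x hx).1 (lt_of_le_of_ne (hle x hx).2 hne)
  have hprev (t : ℤ) (ht : ∀ x, m < x → x ≤ M → w (x + t + p) = w (x + t)) :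
      w (m + t + p) = w (m + t) :=
    eq_of_shift_sum_eq hsum hm (hgF hm) fun x hx hne =>
      ht x (lt_of_le_of_ne (hle x hx).1 hne.symm) (hle x hx).2
  have hall (t : ℤ) : ∀ x, m ≤ x → x < M → w (x + t + p) = w (x + t) := by
    induction t using Int.inductionOn' (b := a - m) with
    | zero =>
      intro x hmx hxM
      have h := hap (x - m).toNat (by omega)
      rw [Int.toNat_of_nonneg (by omega)] at h
      rwa [show x + (a - m) = a + (x - m) by ring]
    | succ t _ ih =>
      intro x hmx hxM
      rw [show x + (t + 1) = (x + 1) + t by ring]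
      rcases eq_or_lt_of_le (Int.add_one_le_of_lt hxM) with h | h
      · rw [h]
        exact hnext t ih
      · exact ih (x + 1) (by omega) h
    | pred t _ ih =>
      have hshift (x : ℤ) (hmx : m < x) (hxM : x ≤ M) :
          w (x + (t - 1) + p) = w (x + (t - 1)) := by
        rw [show x + (t - 1) = (x - 1) + t by ring]
        exact ih (x - 1) (by omega) (by omega)
      intro x hmx hxM
      rcases eq_or_lt_of_le hmx with rfl | h
      · exact hprev (t - 1) hshift
      · exact hshift x h hxM.le
  refine ⟨p, hp, fun i => ?_⟩
  simpa using hnext (i - M) (hall (i - M))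
end

section
/- Let (F,g) be a one-dimensional figure with weights, let A be a finite alphabet (say A = Fin k), and let w : ℤ → A be a word with abelian pattern complexity 1 over (F,g). Then w is periodic, i.e., there is an integer p > 0 with w(i+p) = w(i) for all i ∈ ℤ. -/
/-- If `D` is annihilated by the finite correlation with `g` on `F` and vanishes on a window of
integers as long as the span of `F`, then it vanishes on the two neighbouring windows, hence
everywhere. -/
theorem eq_zero_of_sum_mul_shift_eq_zero (F : Finset ℤ) (hF : F.Nonempty) (g : ℤ → ℤ)
    (hg : ∀ x ∈ F, g x ≠ 0) (D : ℤ → ℤ) (hD : ∀ t : ℤ, ∑ x ∈ F, g x * D (x + t) = 0)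
    (s : ℤ) (hs : ∀ j, s ≤ j → j ≤ s + (F.max' hF - F.min' hF) → D j = 0) (i : ℤ) :
    D i = 0 := by
  have isolate (y : ℤ) (hy : y ∈ F) (t : ℤ) (h : ∀ x ∈ F, x ≠ y → D (x + t) = 0) :
      D (y + t) = 0 := by
    have hsum := hD t
    rw [Finset.sum_eq_single_of_mem y hy fun x hx hxy => by rw [h x hx hxy, mul_zero]] at hsum
    exact (mul_eq_zero.mp hsum).resolve_left (hg y hy)
  have hmin_le (x : ℤ) (hx : x ∈ F) : F.min' hF ≤ x := F.min'_le x hx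
  have hle_max (x : ℤ) (hx : x ∈ F) : x ≤ F.max' hF := F.le_max' x hx
  have hmax_mem := F.max'_mem hF
  have hmin_mem := F.min'_mem hF
  generalize F.max' hF = M at *
  generalize F.min' hF = m at *
  have hmM : m ≤ M := hmin_le M hmax_mem
  have window (n : ℤ) : ∀ j, n ≤ j → j ≤ n + (M - m) → D j = 0 := by
    induction n using Int.inductionOn' (b := s) with
    | zero => exact hs
    | succ n _ ih =>
      intro j h1 h2
      by_cases hj : j ≤ n + (M - m)
      · exact ih j (by lia) hj
      · have := isolate M hmax_mem (j - M) fun x hx hne => ih _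
          (by have := hmin_le x hx; lia) (by have := hle_max x hx; lia)
        rwa [add_sub_cancel] at this
    | pred n _ ih =>
      intro j h1 h2
      by_cases hj : n ≤ j
      · exact ih j hj (by lia)
      · have := isolate m hmin_mem (j - m) fun x hx hne => ih _
          (by have := hmin_le x hx; lia) (by have := hle_max x hx; lia)
        rwa [add_sub_cancel] at this
  exact window i i le_rfl (by lia)

/-- A word over a finite alphabet contains two equal factors of any prescribed length. -/
theorem exists_equal_windows {A : Type*} [Finite A] (w : ℤ → A) (n : ℕ) :
    ∃ s p : ℤ, 0 < p ∧ ∀ j, s ≤ j → j ≤ s + n → w (j + p) = w j := by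
  obtain ⟨a, b, hab, h⟩ := Finite.exists_ne_map_eq_of_infinite
    fun (s : ℤ) (j : Fin (n + 1)) => w (s + (j : ℕ))
  wlog hlt : a < b generalizing a b
  · exact this b a hab.symm h.symm (by lia)
  refine ⟨a, b - a, by lia, fun j h1 h2 => ?_⟩
  have := congrFun h ⟨(j - a).toNat, by lia⟩
  dsimp only at this
  rw [Int.toNat_of_nonneg (by lia), add_sub_cancel] at this
  rw [this]
  congr 1
  ring

/-- If all weighted letter counts are constant, so is any weighted sum of letter values. -/
theorem sum_mul_eq_of_sum_filter_eq {A : Type*} [Fintype A] [DecidableEq A] (F : Finset ℤ)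
    (g : ℤ → ℤ) (w : ℤ → A) (c : A → ℤ) (t t' : ℤ)
    (h : ∀ a : A, ∑ x ∈ F.filter (fun x => w (x + t) = a), g x =
      ∑ x ∈ F.filter (fun x => w (x + t') = a), g x) :
    ∑ x ∈ F, g x * c (w (x + t)) = ∑ x ∈ F, g x * c (w (x + t')) := by
  have expand (t : ℤ) : ∑ x ∈ F, g x * c (w (x + t)) =
      ∑ a : A, (∑ x ∈ F.filter (fun x => w (x + t) = a), g x) * c a := by
    rw [← Finset.sum_fiberwise F (fun x => w (x + t))]
    refine Finset.sum_congr rfl fun a _ => ?_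
    rw [Finset.sum_mul]
    refine Finset.sum_congr rfl fun x hx => ?_
    rw [(Finset.mem_filter.mp hx).2]
  simp only [expand, h]

/-- Let (F,g) be a one-dimensional figure with weights, let A = Fin k be a
finite alphabet, and let w : ℤ → Fin k be a word with abelian pattern complexity 1 over
(F,g), i.e. for every letter a the weighted count t ↦ ∑_{x ∈ F, w(x+t)=a} g(x) does not
depend on t. Then w is periodic. -/
theorem stmt1 (F : Finset ℤ) (hF : F.Nonempty) (g : ℤ → ℤ)
    (hg : ∀ x : ℤ, x ∈ F ↔ g x ≠ 0)
    (k : ℕ) (w : ℤ → Fin k)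
    (hcomp : ∀ (a : Fin k) (t t' : ℤ),
      ∑ x ∈ F.filter (fun x => w (x + t) = a), g x =
      ∑ x ∈ F.filter (fun x => w (x + t') = a), g x) :
    ∃ p : ℤ, 0 < p ∧ ∀ i : ℤ, w (i + p) = w i := by
  obtain ⟨s, p, hp, hsp⟩ := exists_equal_windows w (F.max' hF - F.min' hF).toNat
  refine ⟨p, hp, fun i => ?_⟩
  have hnonneg : F.min' hF ≤ F.max' hF := F.min'_le _ (F.max'_mem hF)
  have hD := eq_zero_of_sum_mul_shift_eq_zero F hF g (fun x hx => (hg x).mp hx)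
    (fun j => ((w (j + p) : ℕ) : ℤ) - ((w j : ℕ) : ℤ)) (fun t => ?_) s
    (fun j h1 h2 => by simp [hsp j h1 (by lia)]) i
  · exact Fin.ext (by lia)
  · simp only [mul_sub, Finset.sum_sub_distrib, sub_eq_zero, add_assoc]
    exact sum_mul_eq_of_sum_filter_eq F g w (fun a => ((a : ℕ) : ℤ)) (t + p) t
      fun a => hcomp a (t + p) t
end

section
/- Let (F,g) be a one-dimensional figure with weights such that F ⊆ ℕ and 0 ∈ F. Then the following are equivalent: (i) there exists a function w : ℤ → ℂ with finite range, not identically zero, such that ∑_{x ∈ F} w(x+t)·g(x) = 0 for every t ∈ ℤ; (ii) there exists an integer n ≥ 1 such that the n-th cyclotomic polynomial Φ_n divides Poly(X) = ∑_{x ∈ F} g(x)·X^x in ℚ[X]. -/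
/-- A bi-infinite sequence killed by a linear recurrence with nonzero extreme coefficients vanishes
as soon as it vanishes on a long enough window. -/
theorem eq_zero_of_recurrence_of_window {K : Type*} [Field K] {F : Finset ℤ} {g : ℤ → K} {d : ℤ}
    (hnonneg : ∀ x ∈ F, 0 ≤ x) (hle : ∀ x ∈ F, x ≤ d) (h0F : 0 ∈ F) (hdF : d ∈ F)
    (hg0 : g 0 ≠ 0) (hgd : g d ≠ 0) {v : ℤ → K}
    (hv : ∀ t, ∑ x ∈ F, v (x + t) * g x = 0) {i : ℤ}
    (hi : ∀ s, i ≤ s → s ≤ i + d → v s = 0) : v = 0 := by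
  have hd : 0 ≤ d := hnonneg d hdF
  have window : ∀ k s : ℤ, k ≤ s → s ≤ k + d → v s = 0 := by
    intro k
    induction k using Int.inductionOn' (b := i) with
    | zero => exact hi
    | succ k _ ih =>
      intro s hs hs'
      by_cases hlt : s ≤ k + d
      · exact ih s (by lia) hlt
      obtain rfl : s = d + (k + 1) := by lia
      have h := hv (k + 1)
      rw [Finset.sum_eq_single_of_mem d hdF fun x hx hne => ?_] at h
      · exact (mul_eq_zero.mp h).resolve_right hgd
      · have := hnonneg x hx
        have := hle x hx
        rw [ih (x + (k + 1)) (by lia) (by lia), zero_mul]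
    | pred k _ ih =>
      intro s hs hs'
      by_cases hlt : k ≤ s
      · exact ih s hlt (by lia)
      obtain rfl : s = 0 + (k - 1) := by lia
      have h := hv (k - 1)
      rw [Finset.sum_eq_single_of_mem 0 h0F fun x hx hne => ?_] at h
      · exact (mul_eq_zero.mp h).resolve_right hg0
      · have := hnonneg x hx
        have := hle x hx
        rw [ih (x + (k - 1)) (by lia) (by lia), zero_mul]
  funext t
  exact window t t le_rfl (by lia)

/-- A finitely valued bi-infinite sequence killed by a linear recurrence with nonzero extreme
coefficients is periodic. -/
theorem exists_period_of_recurrence {K : Type*} [Field K] {F : Finset ℤ} {g : ℤ → K} {d : ℤ}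
    (hnonneg : ∀ x ∈ F, 0 ≤ x) (hle : ∀ x ∈ F, x ≤ d) (h0F : 0 ∈ F) (hdF : d ∈ F)
    (hg0 : g 0 ≠ 0) (hgd : g d ≠ 0) {w : ℤ → K} (hfin : (Set.range w).Finite)
    (hw : ∀ t, ∑ x ∈ F, w (x + t) * g x = 0) :
    ∃ N : ℕ, 0 < N ∧ ∀ t, w (t + N) = w t := by
  have : Finite (Set.range w) := hfin
  obtain ⟨i, j, hij, heq⟩ : ∃ i j : ℕ, i < j ∧
      ∀ k : Fin (d.toNat + 1), w ((i : ℤ) + (k : ℕ)) = w ((j : ℤ) + (k : ℕ)) := by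
    obtain ⟨i, j, hne, heq⟩ := Finite.exists_ne_map_eq_of_infinite
      fun (i : ℕ) (k : Fin (d.toNat + 1)) => Set.rangeFactorization w ((i : ℤ) + (k : ℕ))
    have heq' (k : Fin (d.toNat + 1)) : w ((i : ℤ) + (k : ℕ)) = w ((j : ℤ) + (k : ℕ)) :=
      congrArg Subtype.val (congrFun heq k)
    rcases hne.lt_or_gt with h | h
    · exact ⟨i, j, h, heq'⟩
    · exact ⟨j, i, h, fun k => (heq' k).symm⟩
  refine ⟨j - i, by lia, fun t => ?_⟩
  have hv : (fun t => w (t + (j - i : ℕ)) - w t) = 0 := by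
    refine eq_zero_of_recurrence_of_window hnonneg hle h0F hdF hg0 hgd (i := i)
      (fun t => ?_) fun s hs hs' => ?_
    · simp only [sub_mul, Finset.sum_sub_distrib, hw t, add_assoc, hw (t + (j - i : ℕ)), sub_zero]
    · have h := heq ⟨(s - i).toNat, by lia⟩
      simp only at h
      rw [show (i : ℤ) + (s - i).toNat = s by lia,
        show (j : ℤ) + (s - i).toNat = s + (j - i : ℕ) by lia] at h
      rw [h, sub_self]
  exact sub_eq_zero.mp (congrFun hv t)

/-- The shift operator on bi-infinite complex sequences. -/
noncomputable def shiftEnd : Module.End ℚ (ℤ → ℂ) := LinearMap.funLeft ℚ ℂ (· + 1)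

theorem shiftEnd_pow_apply (n : ℕ) (w : ℤ → ℂ) (t : ℤ) : (shiftEnd ^ n) w t = w (t + n) := by
  induction n generalizing t with
  | zero => simp
  | succ n ih =>
    rw [pow_succ', Module.End.mul_apply]
    change (shiftEnd ^ n) w (t + 1) = _
    rw [ih]
    congr 1
    push_cast
    ring

open Polynomial in
theorem aeval_shiftEnd_apply {F : Finset ℤ} (hnonneg : ∀ x ∈ F, 0 ≤ x) (g : ℤ → ℤ)
    (w : ℤ → ℂ) (t : ℤ) :
    aeval shiftEnd (map (Int.castRingHom ℚ) (∑ x ∈ F, C (g x) * X ^ x.toNat)) w t =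
      ∑ x ∈ F, w (x + t) * (g x : ℂ) := by
  simp only [Polynomial.map_sum, Polynomial.map_mul, Polynomial.map_pow, map_C, map_X, map_sum,
    map_mul, map_pow, aeval_C, aeval_X, LinearMap.sum_apply, Finset.sum_apply]
  refine Finset.sum_congr rfl fun x hx => ?_
  rw [Module.End.mul_apply, Module.algebraMap_end_apply, Pi.smul_apply, shiftEnd_pow_apply,
    Int.toNat_of_nonneg (hnonneg x hx), add_comm t x, Algebra.smul_def, mul_comm]
  simp

open Polynomial in
/-- A rational polynomial in the shift that kills a nonzero periodic sequence has a cyclotomic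
factor. -/
theorem exists_cyclotomic_dvd_of_period {p : ℚ[X]} {w : ℤ → ℂ} (hw : w ≠ 0)
    (hp : aeval shiftEnd p w = 0) {N : ℕ} (hN : 0 < N) (hper : ∀ t, w (t + N) = w t) :
    ∃ n : ℕ, 1 ≤ n ∧ cyclotomic n ℚ ∣ p := by
  by_contra! hndvd
  have hcop : IsCoprime p (X ^ N - 1) := by
    rw [← prod_cyclotomic_eq_X_pow_sub_one hN]
    refine IsCoprime.prod_right fun n hn => IsCoprime.symm ?_
    have hnpos := Nat.pos_of_mem_divisors hn
    exact (cyclotomic.irreducible_rat hnpos).coprime_iff_not_dvd.mpr (hndvd n hnpos)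
  obtain ⟨a, b, hab⟩ := hcop
  have hq : aeval shiftEnd (X ^ N - 1 : ℚ[X]) w = 0 := by
    funext t
    simp [shiftEnd_pow_apply, hper]
  apply hw
  have h := congrArg (fun q => aeval shiftEnd q w) hab
  simpa only [map_add, map_mul, LinearMap.add_apply, Module.End.mul_apply, hp, hq, map_zero,
    add_zero, map_one, Module.End.one_apply, eq_comm] using h


/-- Let (F,g) be a one-dimensional figure with weights with F ⊆ ℕ and 0 ∈ F.
Then there exists a non-zero function w : ℤ → ℂ with finite range such that
∑_{x ∈ F} w(x+t)·g(x) = 0 for every t ∈ ℤ, if and only if there exists n ≥ 1 such that the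
n-th cyclotomic polynomial divides Poly(X) = ∑_{x ∈ F} g(x)·X^x in ℚ[X]. -/
theorem stmt2 (F : Finset ℤ) (hF : F.Nonempty) (g : ℤ → ℤ)
    (hg : ∀ x : ℤ, x ∈ F ↔ g x ≠ 0)
    (hFnat : ∀ x ∈ F, (0 : ℤ) ≤ x) (h0F : (0 : ℤ) ∈ F) :
    (∃ w : ℤ → ℂ, (Set.range w).Finite ∧ w ≠ 0 ∧
      ∀ t : ℤ, ∑ x ∈ F, w (x + t) * (g x : ℂ) = 0) ↔
    (∃ n : ℕ, 1 ≤ n ∧ Polynomial.cyclotomic n ℚ ∣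
      Polynomial.map (Int.castRingHom ℚ)
        (∑ x ∈ F, Polynomial.C (g x) * Polynomial.X ^ x.toNat)) := by
  constructor
  · rintro ⟨w, hfin, hw, hsum⟩
    have hcast : ∀ x ∈ F, (g x : ℂ) ≠ 0 := fun x hx => Int.cast_ne_zero.mpr ((hg x).mp hx)
    obtain ⟨N, hN, hper⟩ := exists_period_of_recurrence (g := fun x => (g x : ℂ)) hFnat
      (fun x hx => F.le_max' x hx) h0F (F.max'_mem hF) (hcast _ h0F) (hcast _ (F.max'_mem hF))
      hfin hsum
    refine exists_cyclotomic_dvd_of_period hw (funext fun t => ?_) hN hper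
    rw [aeval_shiftEnd_apply hFnat, hsum t, Pi.zero_apply]
  · rintro ⟨n, hn, q, hq⟩
    have hn0 : n ≠ 0 := by lia
    have : NeZero n := ⟨hn0⟩
    have hζ := Complex.isPrimitiveRoot_exp n hn0
    set ζ := Complex.exp (2 * Real.pi * Complex.I / n)
    have hζ0 : ζ ≠ 0 := hζ.ne_zero hn0
    have hroot : ∑ x ∈ F, (g x : ℂ) * ζ ^ x.toNat = 0 := by
      have h := congrArg (Polynomial.aeval ζ) hq
      have hcyc : Polynomial.aeval ζ (Polynomial.cyclotomic n ℚ) = 0 := by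
        rw [Polynomial.aeval_def, Polynomial.eval₂_eq_eval_map, Polynomial.map_cyclotomic]
        exact hζ.isRoot_cyclotomic hn
      rw [map_mul, hcyc, zero_mul] at h
      simpa [Polynomial.map_sum] using h
    refine ⟨fun t => ζ ^ t, ?_, fun h => ?_, fun t => ?_⟩
    · refine ((Finset.range n).image fun k : ℕ => ζ ^ k).finite_toSet.subset ?_
      rintro _ ⟨t, rfl⟩
      have hpos : (0 : ℤ) < n := by lia
      have := Int.emod_nonneg t hpos.ne'
      have := Int.emod_lt_of_pos t hpos
      simp only [Finset.coe_image, Set.mem_image, Finset.mem_coe, Finset.mem_range]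
      refine ⟨(t % n).toNat, by lia, ?_⟩
      rw [← zpow_natCast, Int.toNat_of_nonneg (by assumption)]
      conv_rhs => rw [← Int.emod_add_mul_ediv t n]
      rw [zpow_add₀ hζ0, zpow_mul, zpow_natCast ζ n, hζ.pow_eq_one, one_zpow, mul_one]
    · simpa using congrFun h 0
    · rw [← mul_zero (ζ ^ t), ← hroot, Finset.mul_sum]
      refine Finset.sum_congr rfl fun x hx => ?_
      beta_reduce
      rw [zpow_add₀ hζ0, ← zpow_natCast ζ x.toNat, Int.toNat_of_nonneg (hFnat x hx)]
      ring
end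

section
/- Let F = {0,1,2} ⊆ ℤ with weights g(0) = 1, g(1) = −1, g(2) = 1 (the figure of the 6-th cyclotomic polynomial Φ₆(X) = X² − X + 1). Then every word w : ℤ → A over a finite alphabet A with abelian pattern complexity 1 over (F,g) is constant. -/
/-- The weight function of the figure of the 6-th cyclotomic polynomial
Φ₆(X) = X² − X + 1 : weights 1, −1, 1 at the points 0, 1, 2. -/
def phi6Weight : ℤ → ℤ := fun x =>
  if x = 0 then 1 else if x = 1 then -1 else if x = 2 then 1 else 0

/-- The weighted count of `a` at `t`, as an alternating sum of indicators. -/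
theorem sum_filter_phi6Weight {A : Type*} [DecidableEq A] (w : ℤ → A) (a : A) (t : ℤ) :
    ∑ x ∈ ({0, 1, 2} : Finset ℤ).filter (fun x => w (x + t) = a), phi6Weight x =
      (if w t = a then 1 else 0) - (if w (t + 1) = a then 1 else 0) +
        (if w (t + 2) = a then 1 else 0) := by
  rw [Finset.sum_filter, Finset.sum_insert (by decide), Finset.sum_insert (by decide),
    Finset.sum_singleton, zero_add, add_comm 1 t, add_comm 2 t]
  simp only [phi6Weight]
  split_ifs <;> simp_all

/-- Let F = {0,1,2} with weights g(0) = 1, g(1) = −1, g(2) = 1. Then every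
word w : ℤ → A over a finite alphabet A with abelian pattern complexity 1 over (F,g) is
constant. -/
theorem stmt5 (A : Type*) [Fintype A] [DecidableEq A] (w : ℤ → A)
    (hcomp : ∀ (a : A) (t t' : ℤ),
      ∑ x ∈ ({0, 1, 2} : Finset ℤ).filter (fun x => w (x + t) = a), phi6Weight x =
      ∑ x ∈ ({0, 1, 2} : Finset ℤ).filter (fun x => w (x + t') = a), phi6Weight x) :
    ∀ i j : ℤ, w i = w j := by
  intro i j
  obtain ⟨u, hu⟩ : ∃ u : ℤ → ℤ, ∀ t, u t = if w t = w i then 1 else 0 := ⟨_, fun _ => rfl⟩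
  have hcount (t t' : ℤ) := hcomp (w i) t t'
  simp only [sum_filter_phi6Weight, ← hu] at hcount
  have hbound (t : ℤ) : 0 ≤ u t ∧ u t ≤ 1 := by rw [hu]; split_ifs <;> simp
  -- Adding the counts at `t` and `t + 1` gives `u t + u (t + 3) = 2 * c`, so parity forces `u = c`.
  have hi := hcount i (i + 1)
  have hij := hcount i j
  have hj := hcount j (j + 1)
  simp only [add_assoc, Int.reduceAdd] at hi hj
  have hui : u i = 1 := by simp [hu]
  have huj : u j = 1 := by
    have := hbound (i + 3)
    have := hbound j
    have := hbound (j + 3)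
    omega
  by_contra hne
  simp [hu, Ne.symm hne] at huj
end

section
/- Let F ⊆ ℤ² be a convex figure. Then char(F) has a nontrivial strongly linear divisor in R (i.e., there exist v ∈ ℤ² with v ≠ 0 and an integer n ≥ 1 such that l(v,n) divides char(F) in R) if and only if F is not abelian rigid. -/
/-- The embedding of ℤ² into ℝ². -/
def toR2 (p : ℤ × ℤ) : ℝ × ℝ := ((p.1 : ℝ), (p.2 : ℝ))

/-- A convex figure: a finite nonempty subset of ℤ² containing every integer point of its
real convex hull. -/
def IsConvexFigure (F : Finset (ℤ × ℤ)) : Prop :=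
  F.Nonempty ∧ ∀ z : ℤ × ℤ, toR2 z ∈ convexHull ℝ (toR2 '' (F : Set (ℤ × ℤ))) → z ∈ F

/-- A word w : ℤ² → A has abelian pattern complexity 1 over a finite set F ⊆ ℤ² if for
every letter a the count t ↦ #{x ∈ F : w(x+t) = a} does not depend on t. -/
def AbelianComplexityOne {A : Type*} [DecidableEq A] (F : Finset (ℤ × ℤ))
    (w : ℤ × ℤ → A) : Prop :=
  ∀ (a : A) (t t' : ℤ × ℤ),
    (F.filter (fun x => w (x + t) = a)).card = (F.filter (fun x => w (x + t') = a)).card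

/-- A word on ℤ² is fully periodic if it admits two ℤ-linearly independent period
vectors. -/
def FullyPeriodic {A : Type*} (w : ℤ × ℤ → A) : Prop :=
  ∃ p q : ℤ × ℤ, LinearIndependent ℤ ![p, q] ∧
    (∀ x : ℤ × ℤ, w (x + p) = w x) ∧ (∀ x : ℤ × ℤ, w (x + q) = w x)

/-- A finite set F ⊆ ℤ² is abelian rigid if every word over a finite alphabet with abelian
pattern complexity 1 over F is fully periodic. -/
def AbelianRigid (F : Finset (ℤ × ℤ)) : Prop :=
  ∀ k : ℕ, 1 ≤ k → ∀ w : ℤ × ℤ → Fin k, AbelianComplexityOne F w → FullyPeriodic w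

/-- The two-variable Laurent polynomial ring R. -/
abbrev LaurentR := AddMonoidAlgebra ℤ (ℤ × ℤ)

/-- The monomial x^v in the Laurent polynomial ring. -/
noncomputable def mono (v : ℤ × ℤ) : LaurentR := AddMonoidAlgebra.single v 1

/-- The characteristic Laurent polynomial char(F) = ∑_{x ∈ F} x^x of a finite set F ⊆ ℤ². -/
noncomputable def charPoly (F : Finset (ℤ × ℤ)) : LaurentR := ∑ x ∈ F, mono x

/-- The strongly linear Laurent polynomial l(v,n) = ∑_{i=0}^n x^{i·v}. -/
noncomputable def stronglyLinear (v : ℤ × ℤ) (n : ℕ) : LaurentR :=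
  ∑ i ∈ Finset.range (n + 1), mono (i • v)


namespace LaurentR

open AddMonoidAlgebra

/-- The cross product (determinant) of two vectors of ℤ². -/
def cross (u v : ℤ × ℤ) : ℤ := u.1 * v.2 - u.2 * v.1

theorem norm_sq_ne_zero {v : ℤ × ℤ} (hv : v ≠ 0) : v.1 * v.1 + v.2 * v.2 ≠ 0 := fun h =>
  hv (Prod.ext (by nlinarith [mul_self_nonneg v.1, mul_self_nonneg v.2] : v.1 = 0)
    (by nlinarith [mul_self_nonneg v.1, mul_self_nonneg v.2] : v.2 = 0))

theorem mono_zero : mono 0 = 1 := rfl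

theorem mono_add (u v : ℤ × ℤ) : mono (u + v) = mono u * mono v := by
  simp [mono, single_mul_single]

theorem mono_nsmul (n : ℕ) (v : ℤ × ℤ) : mono (n • v) = mono v ^ n := by
  simp [mono, single_pow]

theorem mono_neg_mul (v : ℤ × ℤ) : mono (-v) * mono v = 1 := by
  rw [← mono_add, neg_add_cancel, mono_zero]

theorem stronglyLinear_eq (v : ℤ × ℤ) (n : ℕ) :
    stronglyLinear v n = ∑ i ∈ Finset.range (n + 1), mono v ^ i :=
  Finset.sum_congr rfl fun i _ => mono_nsmul i v

theorem geom_sum_dvd_geom_sum_mul {S : Type*} [CommRing S] (x : S) (g k : ℕ) :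
    ∑ i ∈ Finset.range g, x ^ i ∣ ∑ i ∈ Finset.range (g * k), x ^ i := by
  induction k with
  | zero => simp
  | succ k ih =>
    rw [Nat.mul_succ, Finset.sum_range_add]
    refine dvd_add ih ⟨x ^ (g * k), ?_⟩
    rw [Finset.sum_mul]
    exact Finset.sum_congr rfl fun i _ => by ring

theorem stronglyLinear_dvd {g n : ℕ} (hg : 1 ≤ g) (h : g ∣ n + 1) (v : ℤ × ℤ) :
    stronglyLinear v (g - 1) ∣ stronglyLinear v n := by
  obtain ⟨k, hk⟩ := h
  rw [stronglyLinear_eq, stronglyLinear_eq, hk, Nat.sub_add_cancel hg]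
  exact geom_sum_dvd_geom_sum_mul _ _ _

/-- Laurent polynomials act on configurations: `mono v` acts as the translation
`c ↦ (x ↦ c (x + v))`. -/
noncomputable def shiftAction : LaurentR →ₐ[ℤ] Module.End ℤ (ℤ × ℤ → ℤ) :=
  AddMonoidAlgebra.lift ℤ (Module.End ℤ (ℤ × ℤ → ℤ)) (ℤ × ℤ)
    { toFun := fun v => LinearMap.funLeft ℤ ℤ fun x => x + v.toAdd
      map_one' := by ext; simp [LinearMap.funLeft]
      map_mul' := fun u v => by
        ext c x
        simp [LinearMap.funLeft, Function.comp_def, add_assoc] }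

theorem shiftAction_mono (v : ℤ × ℤ) (c : ℤ × ℤ → ℤ) (x : ℤ × ℤ) :
    shiftAction (mono v) c x = c (x + v) := by
  simp [shiftAction, mono, LinearMap.funLeft]

theorem shiftAction_sum_mono {ι : Type*} (s : Finset ι) (f : ι → ℤ × ℤ) (c : ℤ × ℤ → ℤ)
    (x : ℤ × ℤ) : shiftAction (∑ i ∈ s, mono (f i)) c x = ∑ i ∈ s, c (x + f i) := by
  simp [map_sum, LinearMap.sum_apply, Finset.sum_apply, shiftAction_mono]

theorem shiftAction_mul (p q : LaurentR) (c : ℤ × ℤ → ℤ) :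
    shiftAction (p * q) c = shiftAction p (shiftAction q c) := by
  rw [map_mul, Module.End.mul_apply]

/-- The annihilator ideal of a configuration. -/
noncomputable def annihilator (c : ℤ × ℤ → ℤ) : Ideal LaurentR where
  carrier := {p | shiftAction p c = 0}
  add_mem' {p q} hp hq := by
    simp only [Set.mem_ofPred_eq] at *
    rw [map_add, LinearMap.add_apply, hp, hq, add_zero]
  zero_mem' := by simp
  smul_mem' p q hq := by
    simp only [Set.mem_ofPred_eq, smul_eq_mul] at *
    rw [shiftAction_mul, hq, map_zero]

theorem mem_annihilator {p : LaurentR} {c : ℤ × ℤ → ℤ} :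
    p ∈ annihilator c ↔ shiftAction p c = 0 := Iff.rfl

theorem mem_annihilator_shiftAction {p q : LaurentR} {c : ℤ × ℤ → ℤ} :
    q ∈ annihilator (shiftAction p c) ↔ q * p ∈ annihilator c := by
  rw [mem_annihilator, mem_annihilator, shiftAction_mul]

/-- The vectors that act trivially modulo an ideal. -/
noncomputable def periods (I : Ideal LaurentR) : AddSubgroup (ℤ × ℤ) where
  carrier := {v | mono v - 1 ∈ I}
  add_mem' {u v} hu hv := by
    have h := I.add_mem (I.mul_mem_left (mono u) hv) hu
    simp only [Set.mem_ofPred_eq]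
    convert h using 1
    rw [mono_add]
    ring
  zero_mem' := by simp [mono_zero]
  neg_mem' {v} hv := by
    have h := I.mul_mem_left (-mono (-v)) hv
    simp only [Set.mem_ofPred_eq]
    convert h using 1
    linear_combination mono_neg_mul v

theorem mem_periods {I : Ideal LaurentR} {v : ℤ × ℤ} : v ∈ periods I ↔ mono v - 1 ∈ I :=
  Iff.rfl

theorem mem_periods_annihilator {c : ℤ × ℤ → ℤ} {v : ℤ × ℤ} :
    v ∈ periods (annihilator c) ↔ ∀ x, c (x + v) = c x := by
  rw [mem_periods, mem_annihilator, funext_iff]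
  simp [shiftAction_mono, sub_eq_zero]

theorem mono_sub_mono_mem_of_sub_mem_periods {I : Ideal LaurentR} {u v : ℤ × ℤ}
    (h : u - v ∈ periods I) : mono u - mono v ∈ I := by
  have h' := I.mul_mem_left (mono v) (mem_periods.1 h)
  rwa [mul_sub, ← mono_add, mul_one, add_sub_cancel] at h'

/-- A configuration with bounded values. -/
def IsBoundedConfig (c : ℤ × ℤ → ℤ) : Prop := ∃ B : ℕ, ∀ x, |c x| ≤ B

theorem IsBoundedConfig.shiftAction {c : ℤ × ℤ → ℤ} (hc : IsBoundedConfig c)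
    (p : LaurentR) : IsBoundedConfig (shiftAction p c) := by
  induction p using AddMonoidAlgebra.induction_on with
  | of v =>
    obtain ⟨B, hB⟩ := hc
    exact ⟨B, fun x => (congrArg abs (shiftAction_mono v c x)).trans_le (hB _)⟩
  | add p q hp hq =>
    obtain ⟨A, hA⟩ := hp
    obtain ⟨B, hB⟩ := hq
    refine ⟨A + B, fun x => ?_⟩
    rw [map_add]
    push_cast
    exact (abs_add_le _ _).trans (add_le_add (hA x) (hB x))
  | smul r p hp =>
    obtain ⟨A, hA⟩ := hp
    refine ⟨r.natAbs * A, fun x => ?_⟩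
    rw [map_smul]
    simp only [LinearMap.smul_apply, Pi.smul_apply, smul_eq_mul, abs_mul]
    push_cast
    exact mul_le_mul_of_nonneg_left (hA x) (abs_nonneg r)

/-- A bounded configuration whose difference in direction `w` is `w`-periodic is itself
`w`-periodic. -/
theorem IsBoundedConfig.mem_periods_of_difference {c : ℤ × ℤ → ℤ} (hc : IsBoundedConfig c)
    {w : ℤ × ℤ} (h : w ∈ periods (annihilator (LaurentR.shiftAction (mono w - 1) c))) :
    w ∈ periods (annihilator c) := by
  rw [mem_periods_annihilator] at h ⊢
  intro x
  obtain ⟨B, hB⟩ := hc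
  have hg : ∀ x, LaurentR.shiftAction (mono w - 1) c x = c (x + w) - c x := fun x => by
    simp [shiftAction_mono]
  simp only [hg] at h
  have key : ∀ k : ℕ, c (x + k • w + w) - c (x + k • w) = c (x + w) - c x ∧
      c (x + k • w) = c x + k * (c (x + w) - c x) := by
    intro k
    induction k with
    | zero => simp
    | succ k ih =>
      rw [succ_nsmul, ← add_assoc]
      refine ⟨(h _).trans ih.1, ?_⟩
      push_cast
      linarith [ih.1, ih.2]
  have h1 := (key (2 * B + 1)).2
  have h2 := abs_le.1 (hB (x + (2 * B + 1) • w))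
  have h3 := abs_le.1 (hB x)
  push_cast at h1
  rcases lt_trichotomy (c (x + w) - c x) 0 with h4 | h4 | h4
  · nlinarith
  · linarith
  · nlinarith

theorem IsBoundedConfig.zsmul_mem_periods_of_difference {c : ℤ × ℤ → ℤ}
    (hc : IsBoundedConfig c) {u : ℤ × ℤ} {L : ℤ}
    (h : L • u ∈ periods (annihilator (LaurentR.shiftAction (mono u - 1) c))) :
    L • u ∈ periods (annihilator c) := by
  apply hc.mem_periods_of_difference
  apply AddSubgroup.zsmul_mem
  rw [mem_periods, mem_annihilator_shiftAction] at h ⊢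
  rwa [mul_comm]

/-- A configuration that is periodic with respect to `L • ℤ²` for some `L ≠ 0`. -/
def IsBiperiodic (c : ℤ × ℤ → ℤ) : Prop :=
  ∃ L : ℤ, L ≠ 0 ∧ ∀ u : ℤ × ℤ, L • u ∈ periods (annihilator c)

theorem isBiperiodic_of_cross_ne_zero {c : ℤ × ℤ → ℤ} {v w : ℤ × ℤ}
    (hv : v ∈ periods (annihilator c)) (hw : w ∈ periods (annihilator c))
    (h : cross v w ≠ 0) : IsBiperiodic c := by
  refine ⟨cross v w, h, fun u => ?_⟩
  have : cross v w • u = cross u w • v + cross v u • w := by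
    ext <;> simp [cross] <;> ring
  rw [this]
  exact add_mem (zsmul_mem hv _) (zsmul_mem hw _)

/-- If, in a shift-closed class of bounded configurations, a single period from `V` forces
biperiodicity, then so does annihilation by a product of differences along vectors of `V`. -/
theorem isBiperiodic_of_prod_mem_annihilator (Q : (ℤ × ℤ → ℤ) → Prop) (V : ℤ × ℤ → Prop)
    (hbdd : ∀ c, Q c → IsBoundedConfig c) (hQ : ∀ c p, Q c → Q (shiftAction p c))
    (hV : ∀ v (L : ℤ), L ≠ 0 → V v → V (L • v))
    (hper : ∀ c v, Q c → V v → v ∈ periods (annihilator c) → IsBiperiodic c)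
    (l : List (ℤ × ℤ)) (hl : ∀ u ∈ l, V u) (v : ℤ × ℤ) (hv : V v) (c : ℤ × ℤ → ℤ) (hc : Q c)
    (h : (mono v - 1) * (l.map fun u => mono u - 1).prod ∈ annihilator c) :
    IsBiperiodic c := by
  induction l generalizing v with
  | nil => exact hper c v hc hv (by simpa [mem_periods] using h)
  | cons u l ih =>
    obtain ⟨L, hL, hLper⟩ := hper _ v (hQ c _ hc) hv
      (mem_periods.2 (mem_annihilator_shiftAction.2 h))
    refine ih (fun x hx => hl x (List.mem_cons_of_mem _ hx)) (L • u)
      (hV u L hL (hl u List.mem_cons_self)) ?_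
    rw [← mem_annihilator_shiftAction]
    apply (hbdd _ (hQ _ _ hc)).zsmul_mem_periods_of_difference
    rw [← shiftAction_mul]
    simpa using hLper u

theorem exists_sum_pow_prime_eq {ι S : Type*} [CommRing S] {p : ℕ} (hp : p.Prime)
    (s : Finset ι) (f : ι → S) : ∃ r, ∑ i ∈ s, f i ^ p = (∑ i ∈ s, f i) ^ p + p * r := by
  classical
  induction s using Finset.induction_on with
  | empty => exact ⟨0, by simp [hp.ne_zero]⟩
  | insert a s ha ih =>
    obtain ⟨r, hr⟩ := ih
    obtain ⟨t, ht⟩ := exists_add_pow_prime_eq hp (f a) (∑ i ∈ s, f i)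
    refine ⟨r - f a * (∑ i ∈ s, f i) * t, ?_⟩
    rw [Finset.sum_insert ha, Finset.sum_insert ha, hr, ht]
    ring

/-- Bounded configurations annihilated by `charPoly F` are annihilated by its dilations by
integers without small prime factors. -/
theorem sum_mono_nsmul_mem_annihilator {F : Finset (ℤ × ℤ)} {c : ℤ × ℤ → ℤ} {B : ℕ}
    (hB : ∀ x, |c x| ≤ B) (hF : charPoly F ∈ annihilator c) (j : ℕ) (hj : j ≠ 0)
    (hprime : ∀ p : ℕ, p.Prime → p ∣ j → F.card * B < p) :
    ∑ x ∈ F, mono (j • x) ∈ annihilator c := by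
  induction j using induction_on_primes with
  | zero => exact absurd rfl hj
  | one => simpa [charPoly] using hF
  | prime_mul p j hp ih =>
    have hlt := hprime p hp (dvd_mul_right p j)
    have hmem := ih (right_ne_zero_of_mul hj) fun q hq hqj => hprime q hq (hqj.mul_left p)
    obtain ⟨r, hr⟩ := exists_sum_pow_prime_eq hp F fun x => mono (j • x)
    have heq : ∑ x ∈ F, mono ((p * j) • x) =
        (∑ x ∈ F, mono (j • x)) ^ p + (p : LaurentR) * r := by
      rw [← hr]
      exact Finset.sum_congr rfl fun x _ => by rw [mul_nsmul', mono_nsmul]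
    have hpow : shiftAction ((∑ x ∈ F, mono (j • x)) ^ p) c = 0 :=
      mem_annihilator.1 (Ideal.pow_mem_of_mem _ hmem _ hp.pos)
    rw [mem_annihilator]
    funext t
    refine Int.eq_zero_of_abs_lt_dvd (m := p) ?_ ?_
    · rw [heq, map_add, LinearMap.add_apply, hpow, zero_add, shiftAction_mul, map_natCast]
      exact ⟨shiftAction r c t, by simp⟩
    · rw [shiftAction_sum_mono]
      calc |∑ x ∈ F, c (t + (p * j) • x)| ≤ ∑ x ∈ F, |c (t + (p * j) • x)| :=
            Finset.abs_sum_le_sum_abs _ _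
        _ ≤ ∑ _x ∈ F, (B : ℤ) := Finset.sum_le_sum fun x _ => hB _
        _ = ((F.card * B : ℕ) : ℤ) := by simp
        _ < p := by exact_mod_cast hlt

theorem exists_dilation_mem_annihilator {F : Finset (ℤ × ℤ)} {c : ℤ × ℤ → ℤ}
    (hc : IsBoundedConfig c) (hF : charPoly F ∈ annihilator c) :
    ∃ M : ℕ, M ≠ 0 ∧ ∀ k : ℕ, ∑ x ∈ F, mono ((1 + k * M) • x) ∈ annihilator c := by
  obtain ⟨B, hB⟩ := hc
  refine ⟨(F.card * B).factorial, Nat.factorial_ne_zero _, fun k => ?_⟩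
  refine sum_mono_nsmul_mem_annihilator hB hF _ (by omega) fun p hp hpj => ?_
  by_contra! hle
  have h := (Nat.dvd_factorial hp.pos hle).mul_left k
  exact hp.one_lt.ne' (Nat.dvd_one.1 ((Nat.dvd_add_left h).1 hpj))

theorem sum_mul_eval_mem {ι S : Type*} [CommRing S] (I : Ideal S) (s : Finset ι)
    (a y : ι → S) (h : ∀ k : ℕ, ∑ i ∈ s, a i * y i ^ k ∈ I) (q : Polynomial S) :
    ∑ i ∈ s, a i * q.eval (y i) ∈ I := by
  induction q using Polynomial.induction_on' with
  | add p q hp hq =>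
    have := I.add_mem hp hq
    rw [← Finset.sum_add_distrib] at this
    simpa [mul_add] using this
  | monomial k r =>
    have := I.mul_mem_left r (h k)
    rw [Finset.mul_sum] at this
    convert this using 2 with i
    simp only [Polynomial.eval_monomial]
    ring

/-- Eliminating all classes but one: `f` groups the points of `F` so that points of the same
class have congruent dilated monomials. -/
theorem fiber_mul_prod_mem {α : Type*} [DecidableEq α] {F : Finset (ℤ × ℤ)}
    {I : Ideal LaurentR} {M : ℕ}
    (h : ∀ k : ℕ, ∑ x ∈ F, mono ((1 + k * M) • x) ∈ I) (f : ℤ × ℤ → α) (u : ℤ × ℤ)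
    (hf : ∀ x ∈ F, f x = f u → M • (x - u) ∈ periods I) :
    (∑ x ∈ F with f x = f u, mono x) *
      ∏ x ∈ F with f x ≠ f u, (mono (M • (x - u)) - 1) ∈ I := by
  set q : Polynomial LaurentR :=
    ∏ x ∈ F with f x ≠ f u, (Polynomial.X - Polynomial.C (mono (M • x))) with hq
  have hsum : ∑ x ∈ F, mono x * q.eval (mono (M • x)) ∈ I := by
    refine sum_mul_eval_mem I F _ _ (fun k => ?_) q
    convert h k using 2 with x
    rw [add_nsmul, one_nsmul, mono_add, mul_nsmul', mono_nsmul k]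
  have hfar : ∑ x ∈ F with f x ≠ f u, mono x * q.eval (mono (M • x)) = 0 := by
    refine Finset.sum_eq_zero fun x hx => ?_
    rw [hq, Polynomial.eval_prod, Finset.prod_eq_zero hx (by simp), mul_zero]
  rw [← Finset.sum_filter_add_sum_filter_not F (fun x => f x = f u), hfar, add_zero] at hsum
  have hnear : (∑ x ∈ F with f x = f u, mono x) * q.eval (mono (M • u)) ∈ I := by
    rw [← Ideal.Quotient.eq_zero_iff_mem] at hsum ⊢
    rw [← hsum, Finset.sum_mul, map_sum, map_sum]
    refine Finset.sum_congr rfl fun x hx => ?_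
    rw [Finset.mem_filter] at hx
    have hxu : Ideal.Quotient.mk I (mono (M • u)) = Ideal.Quotient.mk I (mono (M • x)) := by
      refine (Ideal.Quotient.eq.2 (mono_sub_mono_mem_of_sub_mem_periods ?_)).symm
      rw [← nsmul_sub]
      exact hf x hx.1 hx.2
    simp only [map_mul, hq, Polynomial.eval_prod, map_prod, Polynomial.eval_sub,
      Polynomial.eval_X, Polynomial.eval_C, map_sub, hxu]
  obtain ⟨e, he⟩ : ∃ e, ∏ x ∈ F with f x ≠ f u, (mono (M • (x - u)) - 1) =
      e * q.eval (mono (M • u)) := by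
    refine ⟨∏ x ∈ F with f x ≠ f u, -mono (-(M • u)), ?_⟩
    rw [hq, Polynomial.eval_prod, ← Finset.prod_mul_distrib]
    refine Finset.prod_congr rfl fun x _ => ?_
    have h1 : mono (M • (x - u)) = mono (-(M • u)) * mono (M • x) := by
      rw [← mono_add, nsmul_sub, sub_eq_neg_add]
    rw [h1, Polynomial.eval_sub, Polynomial.eval_X, Polynomial.eval_C]
    linear_combination mono_neg_mul (M • u)
  rw [he, mul_left_comm]
  exact I.mul_mem_left _ hnear

theorem exists_eq_zsmul_primitive {v : ℤ × ℤ} (hv : v ≠ 0) :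
    ∃ (m : ℤ) (d : ℤ × ℤ), m ≠ 0 ∧ v = m • d ∧ ∃ α β : ℤ, α * d.1 + β * d.2 = 1 := by
  have hpos : 0 < Int.gcd v.1 v.2 := by
    rw [Int.gcd_pos_iff]
    by_contra! h
    exact hv (Prod.ext h.1 h.2)
  obtain ⟨a, b, hab, h1, h2⟩ := Int.exists_gcd_one hpos
  refine ⟨Int.gcd v.1 v.2, (a, b), by exact_mod_cast hpos.ne', ?_,
    Int.isCoprime_iff_gcd_eq_one.2 hab⟩
  ext
  · rw [h1]; simp [mul_comm, ← h1]
  · rw [h2]; simp [mul_comm, ← h2]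

theorem eq_add_zsmul_of_cross_eq {d x u : ℤ × ℤ} {α β : ℤ} (hd : α * d.1 + β * d.2 = 1)
    (h : cross d x = cross d u) :
    x = u + ((α * x.1 + β * x.2) - (α * u.1 + β * u.2)) • d := by
  simp only [cross] at h
  ext
  · simp only [Prod.fst_add, Prod.smul_fst, smul_eq_mul]
    linear_combination (u.1 - x.1) * hd - β * h
  · simp only [Prod.snd_add, Prod.smul_snd, smul_eq_mul]
    linear_combination (u.2 - x.2) * hd + α * h

theorem add_nsmul_mem_of_isConvexFigure {F : Finset (ℤ × ℤ)} (hconv : IsConvexFigure F)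
    {a d : ℤ × ℤ} {n i : ℕ} (ha : a ∈ F) (hb : a + n • d ∈ F) (hi : i ≤ n) :
    a + i • d ∈ F := by
  rcases Nat.eq_zero_or_pos n with rfl | hn
  · obtain rfl : i = 0 := by omega
    simpa using ha
  refine hconv.2 _ ?_
  have hn' : (0 : ℝ) < n := by exact_mod_cast hn
  have hi' : (i : ℝ) ≤ n := by exact_mod_cast hi
  have key := (convex_convexHull ℝ (toR2 '' (F : Set (ℤ × ℤ))))
    (subset_convexHull ℝ _ ⟨a, ha, rfl⟩) (subset_convexHull ℝ _ ⟨_, hb, rfl⟩)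
    (a := 1 - i / n) (b := i / n)
    (by rw [sub_nonneg, div_le_one hn']; exact hi') (by positivity) (by ring)
  convert key using 1
  ext <;> simp [toR2] <;> field_simp <;> ring

/-- The intersection of a convex figure with a line in a primitive direction is a segment. -/
theorem exists_fiber_eq {F : Finset (ℤ × ℤ)} (hconv : IsConvexFigure F) {d : ℤ × ℤ} {α β : ℤ}
    (hd : α * d.1 + β * d.2 = 1) {u : ℤ × ℤ} (hu : u ∈ F) :
    ∃ (a : ℤ × ℤ) (n : ℕ),
      ∑ x ∈ F with cross d x = cross d u, mono x = mono a * stronglyLinear d n := by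
  set S := {x ∈ F | cross d x = cross d u} with hS
  set ψ : ℤ × ℤ → ℤ := fun x => α * x.1 + β * x.2 with hψ
  have hne : S.Nonempty := ⟨u, by simp [hS, hu]⟩
  obtain ⟨a, haS, hamin⟩ := S.exists_min_image ψ hne
  obtain ⟨b, hbS, hbmax⟩ := S.exists_max_image ψ hne
  have hline : ∀ x ∈ S, x = a + (ψ x - ψ a) • d := fun x hx =>
    eq_add_zsmul_of_cross_eq hd
      ((Finset.mem_filter.1 hx).2.trans (Finset.mem_filter.1 haS).2.symm)
  obtain ⟨n, hn⟩ := Int.eq_ofNat_of_zero_le (sub_nonneg.2 (hamin b hbS))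
  have hb := hline b hbS
  rw [hn] at hb
  have hcross : ∀ i : ℕ, cross d (a + i • d) = cross d u := fun i => by
    rw [← (Finset.mem_filter.1 haS).2]
    simp [cross]
    ring
  have himage : S = (Finset.range (n + 1)).image fun i : ℕ => a + i • d := by
    ext x
    simp only [Finset.mem_image, Finset.mem_range]
    constructor
    · intro hx
      obtain ⟨i, hi⟩ := Int.eq_ofNat_of_zero_le (sub_nonneg.2 (hamin x hx))
      have := hbmax x hx
      refine ⟨i, by omega, ?_⟩
      have hx' := hline x hx
      rw [hi] at hx'
      rw [hx']
      simp
    · rintro ⟨i, hi, rfl⟩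
      refine Finset.mem_filter.2 ⟨?_, hcross i⟩
      refine add_nsmul_mem_of_isConvexFigure hconv (n := n) (Finset.mem_filter.1 haS).1 ?_ (by omega)
      have hbF := (Finset.mem_filter.1 hbS).1
      rw [hb] at hbF
      simpa using hbF
  refine ⟨a, n, ?_⟩
  rw [himage, Finset.sum_image, stronglyLinear, Finset.mul_sum]
  · exact Finset.sum_congr rfl fun i _ => mono_add _ _
  · intro i _ j _ hij
    have hij' : i • d = j • d := add_left_cancel hij
    have h1 := congrArg Prod.fst hij'
    have h2 := congrArg Prod.snd hij'
    rw [Prod.smul_fst, Prod.smul_fst, nsmul_eq_mul, nsmul_eq_mul] at h1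
    rw [Prod.smul_snd, Prod.smul_snd, nsmul_eq_mul, nsmul_eq_mul] at h2
    have : (i : ℤ) = j := by linear_combination α * h1 + β * h2 - ((i : ℤ) - j) * hd
    exact_mod_cast this

/-- No nontrivial strongly linear polynomial divides `charPoly F`. -/
def NoStronglyLinearDivisor (F : Finset (ℤ × ℤ)) : Prop :=
  ∀ (v : ℤ × ℤ) (n : ℕ), v ≠ 0 → 1 ≤ n → ¬ stronglyLinear v n ∣ charPoly F

theorem eq_zero_of_fiber_mem_annihilator {F : Finset (ℤ × ℤ)} (hconv : IsConvexFigure F)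
    (hdiv : NoStronglyLinearDivisor F) {d : ℤ × ℤ} {α β : ℤ} (hd : α * d.1 + β * d.2 = 1)
    {c : ℤ × ℤ → ℤ}
    (h : ∀ u ∈ F, ∑ x ∈ F with cross d x = cross d u, mono x ∈ annihilator c) : c = 0 := by
  have hd0 : d ≠ 0 := by
    rintro rfl
    simp at hd
  obtain ⟨g, hg⟩ := Int.subgroup_cyclic ((periods (annihilator c)).comap
    ((zmultiplesHom (ℤ × ℤ)) d))
  have hmem : ∀ k : ℤ, g ∣ k ↔ k • d ∈ periods (annihilator c) := fun k => by
    rw [← Int.mem_zmultiples_iff, AddSubgroup.zmultiples_eq_closure, ← hg]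
    simp
  have hlen : ∀ u ∈ F, ∃ (a : ℤ × ℤ) (n : ℕ), g ∣ ((n + 1 : ℕ) : ℤ) ∧
      ∑ x ∈ F with cross d x = cross d u, mono x = mono a * stronglyLinear d n := by
    intro u hu
    obtain ⟨a, n, han⟩ := exists_fiber_eq hconv hd hu
    refine ⟨a, n, ?_, han⟩
    rw [hmem, natCast_zsmul, mem_periods, mono_nsmul, ← geom_sum_mul, ← stronglyLinear_eq]
    have := h u hu
    rw [han] at this
    have := (annihilator c).mul_mem_left (mono (-a) * (mono d - 1)) this
    convert this using 1
    linear_combination (-stronglyLinear d n * (mono d - 1)) * mono_neg_mul a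
  obtain ⟨u, hu⟩ := hconv.1
  have hg0 : g ≠ 0 := by
    rintro rfl
    obtain ⟨a, n, hn, -⟩ := hlen u hu
    rw [zero_dvd_iff] at hn
    omega
  have hg1 : g.natAbs = 1 := by
    by_contra hne
    refine hdiv d (g.natAbs - 1) hd0 (by omega) ?_
    rw [charPoly, ← Finset.sum_fiberwise_of_maps_to (t := F.image (cross d))
      (fun x hx => Finset.mem_image_of_mem _ hx)]
    refine Finset.dvd_sum fun s hs => ?_
    obtain ⟨u, hu, rfl⟩ := Finset.mem_image.1 hs
    obtain ⟨a, n, hn, hsum⟩ := hlen u hu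
    rw [hsum]
    exact (stronglyLinear_dvd (by omega) (Int.natAbs_dvd_natAbs.2 hn) d).mul_left _
  have hall : ∀ k : ℤ, k • d ∈ periods (annihilator c) := fun k =>
    (hmem k).1 ((Int.natAbs_dvd_natAbs).1 (by rw [hg1]; exact one_dvd _))
  funext t
  have hsum := congrFun (mem_annihilator.1 (h u hu)) (t - u)
  rw [shiftAction_sum_mono (f := fun x => x)] at hsum
  have hconst : ∀ x ∈ ({x ∈ F | cross d x = cross d u} : Finset (ℤ × ℤ)),
      c (t - u + x) = c t := by
    intro x hx
    have hx' := eq_add_zsmul_of_cross_eq hd (Finset.mem_filter.1 hx).2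
    rw [hx', ← add_assoc, sub_add_cancel]
    exact mem_periods_annihilator.1 (hall _) t
  rw [Finset.sum_congr rfl hconst, Finset.sum_const] at hsum
  have hcard : Finset.card {x ∈ F | cross d x = cross d u} ≠ 0 :=
    Finset.card_ne_zero_of_mem (Finset.mem_filter.2 ⟨hu, rfl⟩)
  simpa [hcard] using hsum

theorem isBiperiodic_of_mem_periods {F : Finset (ℤ × ℤ)} (hconv : IsConvexFigure F)
    (hdiv : NoStronglyLinearDivisor F) {c : ℤ × ℤ → ℤ} (hc : IsBoundedConfig c)
    (hF : charPoly F ∈ annihilator c) {v : ℤ × ℤ} (hv : v ≠ 0)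
    (hper : v ∈ periods (annihilator c)) : IsBiperiodic c := by
  obtain ⟨m, d, hm, rfl, α, β, hd⟩ := exists_eq_zsmul_primitive hv
  obtain ⟨M, hM, hdil⟩ := exists_dilation_mem_annihilator hc hF
  have hN : M * m.natAbs ≠ 0 := mul_ne_zero hM (Int.natAbs_ne_zero.2 hm)
  have hNper : ∀ k : ℤ, (M * m.natAbs) • k • d ∈ periods (annihilator c) := fun k => by
    obtain ⟨e, he⟩ : m ∣ (M * m.natAbs : ℕ) * k :=
      ((Int.dvd_natCast.2 (dvd_mul_left _ _))).mul_right _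
    rw [← natCast_zsmul, smul_smul, he, mul_comm, mul_smul]
    exact zsmul_mem hper _
  have hfib : ∀ u : ℤ × ℤ, (∑ x ∈ F with cross d x = cross d u, mono x) *
      ∏ x ∈ F with cross d x ≠ cross d u, (mono ((M * m.natAbs) • (x - u)) - 1) ∈
        annihilator c := by
    intro u
    refine fiber_mul_prod_mem (fun k => ?_) (cross d) u fun x _ hxu => ?_
    · have := hdil (k * m.natAbs)
      rwa [mul_assoc, mul_comm m.natAbs] at this
    · rw [sub_eq_iff_eq_add'.2 (eq_add_zsmul_of_cross_eq hd hxu)]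
      exact hNper _
  set l : List (ℤ × ℤ) := F.toList.flatMap fun u =>
    ({x ∈ F | cross d x ≠ cross d u} : Finset (ℤ × ℤ)).toList.map
      fun x => (M * m.natAbs) • (x - u) with hl
  have hprod : (l.map fun u => mono u - 1).prod =
      ∏ u ∈ F, ∏ x ∈ F with cross d x ≠ cross d u,
        (mono ((M * m.natAbs) • (x - u)) - 1) := by
    rw [hl, List.map_flatMap, List.flatMap_def, List.prod_flatten, List.map_map, ← Finset.prod_map_toList]
    simp only [List.map_map, ← Finset.prod_map_toList]
    rfl
  have hzero : shiftAction (l.map fun u => mono u - 1).prod c = 0 := by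
    refine eq_zero_of_fiber_mem_annihilator hconv hdiv hd fun u hu => ?_
    rw [mem_annihilator_shiftAction, hprod, ← Finset.mul_prod_erase F _ hu, ← mul_assoc]
    exact Ideal.mul_mem_right _ _ (hfib u)
  have hw : cross d (-d.2, d.1) ≠ 0 := by
    have hd0 : d ≠ 0 := right_ne_zero_of_smul hv
    simpa [cross] using norm_sq_ne_zero hd0
  refine isBiperiodic_of_prod_mem_annihilator
    (fun c => IsBoundedConfig c ∧ m • d ∈ periods (annihilator c)) (fun w => cross d w ≠ 0)
    (fun _ h => h.1) (fun c p h => ⟨h.1.shiftAction p, ?_⟩) (fun w L hL h => ?_)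
    (fun c w h hw hwper => isBiperiodic_of_cross_ne_zero h.2 hwper ?_) l ?_ (-d.2, d.1) hw c
    ⟨hc, hper⟩ (Ideal.mul_mem_left _ _ hzero)
  · rw [mem_periods, mem_annihilator_shiftAction]
    exact Ideal.mul_mem_right _ _ h.2
  · have : cross d (L • w) = L * cross d w := by simp [cross]; ring
    rw [this]
    exact mul_ne_zero hL h
  · have : cross (m • d) w = m * cross d w := by simp [cross]; ring
    rw [this]
    exact mul_ne_zero hm hw
  · intro w hwl
    simp only [hl, List.mem_flatMap, List.mem_map, Finset.mem_toList, Finset.mem_filter] at hwl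
    obtain ⟨u, -, x, ⟨-, hx⟩, rfl⟩ := hwl
    have : cross d ((M * m.natAbs) • (x - u)) =
        (M * m.natAbs : ℕ) * (cross d x - cross d u) := by
      simp [cross]; ring
    rw [this]
    exact mul_ne_zero (by exact_mod_cast hN) (sub_ne_zero.2 hx)

theorem isBiperiodic_of_charPoly_mem_annihilator {F : Finset (ℤ × ℤ)}
    (hconv : IsConvexFigure F) (hdiv : NoStronglyLinearDivisor F) {c : ℤ × ℤ → ℤ}
    (hc : IsBoundedConfig c) (hF : charPoly F ∈ annihilator c) : IsBiperiodic c := by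
  obtain ⟨M, hM, hdil⟩ := exists_dilation_mem_annihilator hc hF
  obtain ⟨u, hu⟩ := hconv.1
  have hmem := fiber_mul_prod_mem hdil id u fun x _ hx => by
    have hx' : x = u := hx
    simp [hx']
  have hsingle : ∑ x ∈ F with id x = id u, mono x = mono u := by
    simp [Finset.filter_eq', hu]
  rw [hsingle] at hmem
  have hmem' : ∏ x ∈ F with id x ≠ id u, (mono (M • (x - u)) - 1) ∈ annihilator c := by
    have := Ideal.mul_mem_left _ (mono (-u)) hmem
    rwa [← mul_assoc, mono_neg_mul, one_mul] at this
  refine isBiperiodic_of_prod_mem_annihilator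
    (fun c => IsBoundedConfig c ∧ charPoly F ∈ annihilator c) (fun v => v ≠ 0)
    (fun _ h => h.1)
    (fun c p h => ⟨h.1.shiftAction p, mem_annihilator_shiftAction.2
      (Ideal.mul_mem_right _ _ h.2)⟩)
    (fun v L hL hv => smul_ne_zero hL hv)
    (fun c v h hv hper => isBiperiodic_of_mem_periods hconv hdiv h.1 h.2 hv hper)
    (({x ∈ F | id x ≠ id u} : Finset (ℤ × ℤ)).toList.map fun x => M • (x - u)) ?_
    (1, 0) (by simp) c ⟨hc, hF⟩ (Ideal.mul_mem_left _ _ ?_)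
  · intro w hw
    simp only [List.mem_map, Finset.mem_toList, Finset.mem_filter] at hw
    obtain ⟨x, ⟨-, hx⟩, rfl⟩ := hw
    exact smul_ne_zero hM (sub_ne_zero.2 hx)
  · rw [← Finset.prod_map_toList] at hmem'
    rwa [List.map_map]

/-- The indicator configuration of a letter in a word. -/
def letterConfig {A : Type*} [DecidableEq A] (w : ℤ × ℤ → A) (a : A) : ℤ × ℤ → ℤ :=
  fun x => if w x = a then 1 else 0

theorem isBoundedConfig_letterConfig {A : Type*} [DecidableEq A] (w : ℤ × ℤ → A) (a : A) :
    IsBoundedConfig (letterConfig w a) :=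
  ⟨1, fun x => by unfold letterConfig; split_ifs <;> simp⟩

theorem shiftAction_charPoly_letterConfig {A : Type*} [DecidableEq A] (F : Finset (ℤ × ℤ))
    (w : ℤ × ℤ → A) (a : A) (t : ℤ × ℤ) :
    shiftAction (charPoly F) (letterConfig w a) t =
      (F.filter fun x => w (x + t) = a).card := by
  rw [charPoly, shiftAction_sum_mono (f := fun x => x), Finset.card_filter]
  push_cast
  exact Finset.sum_congr rfl fun x _ => by rw [add_comm t x]; simp [letterConfig]

theorem exists_zsmul_mem_periods_letterConfig {F : Finset (ℤ × ℤ)} (hconv : IsConvexFigure F)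
    (hdiv : NoStronglyLinearDivisor F) {A : Type*} [DecidableEq A] {w : ℤ × ℤ → A}
    (hw : AbelianComplexityOne F w) (a : A) (e : ℤ × ℤ) :
    ∃ L : ℤ, L ≠ 0 ∧ L • e ∈ periods (annihilator (letterConfig w a)) := by
  have hbdd := isBoundedConfig_letterConfig w a
  obtain ⟨L, hL, hper⟩ := isBiperiodic_of_charPoly_mem_annihilator hconv hdiv
    (hbdd.shiftAction (mono e - 1)) (by
      rw [mem_annihilator_shiftAction, mul_comm, ← mem_annihilator_shiftAction,
        ← mem_periods, mem_periods_annihilator]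
      intro x
      simp only [shiftAction_charPoly_letterConfig]
      exact_mod_cast hw a _ _)
  exact ⟨L, hL, hbdd.zsmul_mem_periods_of_difference (hper e)⟩

theorem exists_zsmul_period {F : Finset (ℤ × ℤ)} (hconv : IsConvexFigure F)
    (hdiv : NoStronglyLinearDivisor F) {A : Type*} [Fintype A] [DecidableEq A]
    {w : ℤ × ℤ → A} (hw : AbelianComplexityOne F w) (e : ℤ × ℤ) :
    ∃ L : ℤ, L ≠ 0 ∧ ∀ x, w (x + L • e) = w x := by
  choose L hL hper using fun a => exists_zsmul_mem_periods_letterConfig hconv hdiv hw a e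
  refine ⟨∏ a, L a, Finset.prod_ne_zero_iff.2 fun a _ => hL a, fun x => ?_⟩
  have hmem : (∏ a, L a) • e ∈ periods (annihilator (letterConfig w (w x))) := by
    rw [← Finset.prod_erase_mul _ _ (Finset.mem_univ (w x)), mul_smul]
    exact zsmul_mem (hper _) _
  have := mem_periods_annihilator.1 hmem x
  by_contra hne
  rw [letterConfig, letterConfig, if_neg hne, if_pos rfl] at this
  exact zero_ne_one this

theorem abelianRigid_of_noStronglyLinearDivisor {F : Finset (ℤ × ℤ)}
    (hconv : IsConvexFigure F) (hdiv : NoStronglyLinearDivisor F) : AbelianRigid F := by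
  intro k _ w hw
  obtain ⟨L₁, h₁, hper₁⟩ := exists_zsmul_period hconv hdiv hw (1, 0)
  obtain ⟨L₂, h₂, hper₂⟩ := exists_zsmul_period hconv hdiv hw (0, 1)
  refine ⟨_, _, LinearIndependent.pair_iff.2 fun s t hst => ?_, hper₁, hper₂⟩
  simpa [h₁, h₂] using hst

/-- The index of a point along the direction `v`; it increases by one along `v`. -/
def lineIndex (v x : ℤ × ℤ) : ℤ := (v.1 * x.1 + v.2 * x.2) / (v.1 * v.1 + v.2 * v.2)

theorem lineIndex_add_zsmul {v : ℤ × ℤ} (hv : v ≠ 0) (x : ℤ × ℤ) (k : ℤ) :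
    lineIndex v (x + k • v) = lineIndex v x + k := by
  rw [lineIndex, lineIndex, ← Int.add_mul_ediv_right _ _ (norm_sq_ne_zero hv)]
  congr 1
  simp
  ring

/-- A word whose restriction to every line in direction `v` cycles through `n + 1` letters,
with an offset on the line through the origin that destroys transversal periods. -/
def cyclicWord (v : ℤ × ℤ) (n : ℕ) (x : ℤ × ℤ) : ZMod (n + 1) :=
  ((lineIndex v x + if cross v x = 0 then 1 else 0 : ℤ) : ZMod (n + 1))

theorem cyclicWord_add_nsmul {v : ℤ × ℤ} (hv : v ≠ 0) (n : ℕ) (x : ℤ × ℤ) (i : ℕ) :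
    cyclicWord v n (x + i • v) = cyclicWord v n x + i := by
  have hcross : cross v (x + i • v) = cross v x := by simp [cross]; ring
  rw [cyclicWord, cyclicWord, hcross, ← natCast_zsmul, lineIndex_add_zsmul hv]
  push_cast
  ring

theorem shiftAction_stronglyLinear_letterConfig_cyclicWord {v : ℤ × ℤ} (hv : v ≠ 0) (n : ℕ)
    (a : ZMod (n + 1)) :
    shiftAction (stronglyLinear v n) (letterConfig (cyclicWord v n) a) = fun _ => 1 := by
  funext x
  rw [stronglyLinear, shiftAction_sum_mono]
  have : ∀ i : ℕ, letterConfig (cyclicWord v n) a (x + i • v) =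
      if (i : ZMod (n + 1)) = a - cyclicWord v n x then 1 else 0 := by
    intro i
    rw [letterConfig, cyclicWord_add_nsmul hv]
    exact if_congr eq_sub_iff_add_eq'.symm rfl rfl
  simp only [this]
  generalize a - cyclicWord v n x = z
  rw [Finset.sum_eq_single z.val]
  · simp
  · intro i hi hne
    refine if_neg fun h => hne ?_
    rw [← h, ZMod.val_cast_of_lt (Finset.mem_range.1 hi)]
  · exact fun h => absurd (Finset.mem_range.2 (ZMod.val_lt z)) h

theorem abelianComplexityOne_of_dvd {F : Finset (ℤ × ℤ)} {A : Type*} [DecidableEq A]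
    {w : ℤ × ℤ → A} {p : LaurentR} (hp : p ∣ charPoly F)
    (hw : ∀ a, shiftAction p (letterConfig w a) = fun _ => 1) : AbelianComplexityOne F w := by
  obtain ⟨q, hq⟩ := hp
  have hconst : ∀ t, t ∈ periods (annihilator (shiftAction q fun _ => 1)) := fun t => by
    rw [mem_periods, mem_annihilator_shiftAction, mul_comm]
    refine Ideal.mul_mem_left _ _ (mem_annihilator.2 ?_)
    funext x
    simp [shiftAction_mono]
  intro a t t'
  have h := mem_periods_annihilator.1 (hconst (t' - t)) t
  rw [← hw a, ← shiftAction_mul, mul_comm, ← hq, add_sub_cancel] at h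
  simp only [shiftAction_charPoly_letterConfig] at h
  exact_mod_cast h.symm

theorem not_periodic_cyclicWord {v : ℤ × ℤ} (hv : v ≠ 0) {n : ℕ} (hn : 1 ≤ n) {p : ℤ × ℤ}
    (hp : cross v p ≠ 0) : ¬ Function.Periodic (cyclicWord v n) p := by
  intro h
  have : Fact (1 < n + 1) := ⟨by omega⟩
  set N := v.1 * v.1 + v.2 * v.2 with hN
  have hN0 : N ≠ 0 := norm_sq_ne_zero hv
  have hn0 : (n : ℤ) + 1 ≠ 0 := by omega
  have hcross : cross v ((N * (n + 1)) • p) ≠ 0 := by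
    have : cross v ((N * (n + 1)) • p) = N * (n + 1) * cross v p := by simp [cross]; ring
    rw [this]
    exact mul_ne_zero (mul_ne_zero hN0 hn0) hp
  have hindex : lineIndex v ((N * (n + 1)) • p) = (n + 1) * (v.1 * p.1 + v.2 * p.2) := by
    rw [lineIndex, ← hN]
    refine Int.ediv_eq_of_eq_mul_right hN0 ?_
    simp only [Prod.smul_fst, Prod.smul_snd, smul_eq_mul]
    ring
  have hper := h.zsmul (N * (n + 1)) 0
  rw [zero_add, cyclicWord, cyclicWord, if_neg hcross, hindex, if_pos (by simp [cross])] at hper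
  have hchar : ((n : ZMod (n + 1)) + 1) = 0 := by exact_mod_cast ZMod.natCast_self (n + 1)
  simp [lineIndex, hchar] at hper

theorem eq_zero_of_cross_eq_zero_of_dot_eq_zero {v q : ℤ × ℤ} (hv : v ≠ 0)
    (hcross : cross v q = 0) (hdot : v.1 * q.1 + v.2 * q.2 = 0) : q = 0 := by
  have h := norm_sq_ne_zero hv
  rw [cross] at hcross
  refine Prod.ext (mul_left_cancel₀ h ?_) (mul_left_cancel₀ h ?_)
  · simp only [Prod.fst_zero]
    linear_combination v.1 * hdot - v.2 * hcross
  · simp only [Prod.snd_zero]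
    linear_combination v.2 * hdot + v.1 * hcross

theorem not_fullyPeriodic_cyclicWord {v : ℤ × ℤ} (hv : v ≠ 0) {n : ℕ} (hn : 1 ≤ n) :
    ¬ FullyPeriodic (cyclicWord v n) := by
  rintro ⟨p, q, hpq, hp, hq⟩
  rw [LinearIndependent.pair_iff] at hpq
  have hcp : cross v p = 0 := by
    by_contra h
    exact not_periodic_cyclicWord hv hn h hp
  have hcq : cross v q = 0 := by
    by_contra h
    exact not_periodic_cyclicWord hv hn h hq
  have hdot := (hpq (v.1 * q.1 + v.2 * q.2) (-(v.1 * p.1 + v.2 * p.2)) (by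
    simp only [cross] at hcp hcq
    ext
    · simp only [Prod.fst_add, Prod.smul_fst, smul_eq_mul, Prod.fst_zero]
      linear_combination -q.2 * hcp + p.2 * hcq
    · simp only [Prod.snd_add, Prod.smul_snd, smul_eq_mul, Prod.snd_zero]
      linear_combination q.1 * hcp - p.1 * hcq)).1
  have hq0 := eq_zero_of_cross_eq_zero_of_dot_eq_zero hv hcq hdot
  simpa [hq0] using hpq 0 1

end LaurentR

/-- Let F ⊆ ℤ² be a convex figure. Then char(F) has a nontrivial strongly
linear divisor if and only if F is not abelian rigid. -/
theorem stmt6 (F : Finset (ℤ × ℤ)) (hconv : IsConvexFigure F) :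
    (∃ (v : ℤ × ℤ) (n : ℕ), v ≠ 0 ∧ 1 ≤ n ∧ stronglyLinear v n ∣ charPoly F) ↔
    ¬ AbelianRigid F := by
  constructor
  · rintro ⟨v, n, hv, hn, hdvd⟩ hrigid
    exact LaurentR.not_fullyPeriodic_cyclicWord hv hn (hrigid (n + 1) (by omega) _
      (LaurentR.abelianComplexityOne_of_dvd hdvd
        (LaurentR.shiftAction_stronglyLinear_letterConfig_cyclicWord hv n)))
  · intro h
    by_contra! hdiv
    exact h (LaurentR.abelianRigid_of_noStronglyLinearDivisor hconv hdiv)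
end

section
/- Let F ⊆ ℤ² be a convex figure. Then F is relatively prime if and only if F is abelian rigid. -/
/-- F is u-relatively prime if the gcd of the cardinalities of the nonempty intersections
of F with lines parallel to u (the fibers of x ↦ u₂·x₁ − u₁·x₂) equals 1. -/
def URelativelyPrime (F : Finset (ℤ × ℤ)) (u : ℤ × ℤ) : Prop :=
  (F.image (fun x => u.2 * x.1 - u.1 * x.2)).gcd
    (fun c => (F.filter (fun x => u.2 * x.1 - u.1 * x.2 = c)).card) = 1

/-- F is relatively prime if it is u-relatively prime for every nonzero u ∈ ℤ². -/
def RelativelyPrime (F : Finset (ℤ × ℤ)) : Prop :=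
  ∀ u : ℤ × ℤ, u ≠ 0 → URelativelyPrime F u

section Translation

variable {G : Type*} [AddCommGroup G]

/-- The action of the group algebra `R[G]` on functions `G → R` by translations: the monomial with
exponent `v` sends `f` to `x ↦ f (x + v)`. -/
noncomputable def translationHom (R G : Type*) [CommRing R] [AddCommGroup G] :
    AddMonoidAlgebra R G →ₐ[R] Module.End R (G → R) :=
  AddMonoidAlgebra.lift R (Module.End R (G → R)) G
    { toFun := fun v => LinearMap.funLeft R R (fun x => x + v.toAdd)
      map_one' := by ext; simp [LinearMap.funLeft_apply]
      map_mul' := fun v w => by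
        ext
        simp [LinearMap.funLeft_apply, add_comm, add_left_comm] }

theorem translationHom_single {R : Type*} [CommRing R] (v : G) (r : R) (f : G → R) (x : G) :
    translationHom R G (AddMonoidAlgebra.single v r) f x = r * f (x + v) := by
  simp [translationHom, LinearMap.funLeft_apply]

theorem translationHom_sum_single {R ι : Type*} [CommRing R] (s : Finset ι) (g : ι → G)
    (f : G → R) (x : G) :
    translationHom R G (∑ i ∈ s, AddMonoidAlgebra.single (g i) 1) f x = ∑ i ∈ s, f (x + g i) := by
  simp [map_sum, LinearMap.sum_apply, translationHom_single]

/-- The ideal of elements of the group algebra annihilating a function. -/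
noncomputable def annihilatorIdeal {R : Type*} [CommRing R] (f : G → R) :
    Ideal (AddMonoidAlgebra R G) where
  carrier := {a | translationHom R G a f = 0}
  add_mem' := fun {a b} ha hb => by
    simp only [Set.mem_ofPred_eq] at *
    simp [ha, hb]
  zero_mem' := by simp
  smul_mem' := fun b a ha => by
    simp only [Set.mem_ofPred_eq] at *
    simp [ha]

theorem mem_annihilatorIdeal {R : Type*} [CommRing R] {f : G → R} {a : AddMonoidAlgebra R G} :
    a ∈ annihilatorIdeal f ↔ translationHom R G a f = 0 := Iff.rfl

theorem sum_translate_prime_nsmul_eq_zero {ι : Type*} (s : Finset ι) (g : ι → G) (f : G → ℤ)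
    {M : ℕ} (hf : ∀ x, |f x| ≤ M) {p : ℕ} (hp : p.Prime) (hM : s.card * M < p)
    (h : ∀ x, ∑ i ∈ s, f (x + g i) = 0) (x : G) : ∑ i ∈ s, f (x + p • g i) = 0 := by
  have : Fact p.Prime := ⟨hp⟩
  have : CharP (AddMonoidAlgebra (ZMod p) G) p :=
    charP_of_injective_algebraMap
      (algebraMap (ZMod p) (AddMonoidAlgebra (ZMod p) G)).injective p
  set a : AddMonoidAlgebra (ZMod p) G := ∑ i ∈ s, AddMonoidAlgebra.single (g i) 1 with ha
  have h1 : a ∈ annihilatorIdeal (fun x => (f x : ZMod p)) := by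
    rw [mem_annihilatorIdeal]
    ext x
    rw [ha, translationHom_sum_single]
    have := congrArg (Int.cast : ℤ → ZMod p) (h x)
    simpa using this
  have h2 : a ^ p = ∑ i ∈ s, AddMonoidAlgebra.single (p • g i) 1 := by
    rw [ha, sum_pow_char]
    simp [AddMonoidAlgebra.single_pow]
  have h3 := Ideal.pow_mem_of_mem _ h1 p hp.pos
  rw [h2, mem_annihilatorIdeal] at h3
  have h4 := congrFun h3 x
  rw [translationHom_sum_single] at h4
  refine Int.eq_zero_of_abs_lt_dvd (m := p) ?_ ?_
  · rw [← ZMod.intCast_zmod_eq_zero_iff_dvd]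
    simpa using h4
  · calc |∑ i ∈ s, f (x + p • g i)| ≤ ∑ i ∈ s, |f (x + p • g i)| := Finset.abs_sum_le_sum_abs _ _
      _ ≤ ∑ i ∈ s, (M : ℤ) := Finset.sum_le_sum fun i _ => hf _
      _ = ((s.card * M : ℕ) : ℤ) := by simp
      _ < p := by exact_mod_cast hM

theorem sum_translate_nsmul_eq_zero {ι : Type*} (s : Finset ι) (g : ι → G) (f : G → ℤ)
    {M : ℕ} (hf : ∀ x, |f x| ≤ M) (h : ∀ x, ∑ i ∈ s, f (x + g i) = 0) (n : ℕ) (hn : n ≠ 0)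
    (hprime : ∀ p : ℕ, p.Prime → p ∣ n → s.card * M < p) (x : G) :
    ∑ i ∈ s, f (x + n • g i) = 0 := by
  induction n using induction_on_primes generalizing x with
  | zero => exact absurd rfl hn
  | one => simpa using h x
  | prime_mul p n hp ih =>
    have hn0 : n ≠ 0 := right_ne_zero_of_mul hn
    have := sum_translate_prime_nsmul_eq_zero s (fun i => n • g i) f hf hp
      (hprime p hp (dvd_mul_right _ _))
      (ih hn0 fun q hq hqn => hprime q hq (hqn.mul_left p)) x
    simpa [mul_smul] using this

theorem exists_period_of_annihilator {A : Type*} [Finite A] (w : G → A) (φ : A → ℂ)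
    (hφ : Function.Injective φ) (d : G) (Q : Polynomial ℂ) (hQ : Q ≠ 0)
    (h : Polynomial.aeval (AddMonoidAlgebra.single d 1) Q ∈
      annihilatorIdeal (fun x => φ (w x))) :
    ∃ N : ℕ, N ≠ 0 ∧ ∀ x, w (x + N • d) = w x := by
  have hrec : ∀ x, ∑ i ∈ Finset.range (Q.natDegree + 1), Q.coeff i * φ (w (x + i • d)) = 0 := by
    intro x
    rw [mem_annihilatorIdeal, Polynomial.aeval_eq_sum_range] at h
    have := congrFun h x
    simpa [map_sum, LinearMap.sum_apply, AddMonoidAlgebra.single_pow, translationHom_single,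
      map_smul, -map_pow] using this
  set D := Q.natDegree
  let st : G → Fin D → A := fun x i => w (x + (i : ℕ) • d)
  have hdet : ∀ x y, st x = st y → ∀ n : ℕ, w (x + n • d) = w (y + n • d) := by
    intro x y hxy n
    induction n using Nat.strong_induction_on with
    | _ n ih =>
      rcases lt_or_ge n D with hn | hn
      · exact congrFun hxy ⟨n, hn⟩
      · obtain ⟨m, rfl⟩ := Nat.exists_eq_add_of_le hn
        have hx := hrec (x + m • d)
        have hy := hrec (y + m • d)
        rw [Finset.sum_range_succ] at hx hy
        have hsum : ∑ i ∈ Finset.range D, Q.coeff i * φ (w (x + m • d + i • d)) =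
            ∑ i ∈ Finset.range D, Q.coeff i * φ (w (y + m • d + i • d)) := by
          refine Finset.sum_congr rfl fun i hi => ?_
          rw [add_assoc, add_assoc, ← add_smul, ih _ (by have := Finset.mem_range.1 hi; omega)]
        rw [hsum, ← hy] at hx
        have hlc : Q.coeff D ≠ 0 := Polynomial.leadingCoeff_ne_zero.2 hQ
        have := hφ (mul_left_cancel₀ hlc (add_left_cancel hx))
        rwa [add_assoc, add_assoc, ← add_smul, add_comm m D] at this
  set K := Nat.card (Fin D → A)
  refine ⟨K.factorial, Nat.factorial_ne_zero _, fun y => ?_⟩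
  obtain ⟨i, j, hij, hj, hst⟩ : ∃ i j : ℕ, i < j ∧ j < K + 1 ∧
      st (y - K • d + i • d) = st (y - K • d + j • d) := by
    have := Fintype.ofFinite (Fin D → A)
    obtain ⟨i, j, hne, he⟩ := Fintype.exists_ne_map_eq_of_card_lt
      (fun i : Fin (K + 1) => st (y - K • d + (i : ℕ) • d))
      (by simp [K, Nat.card_eq_fintype_card])
    rcases lt_or_gt_of_ne hne with h' | h'
    exacts [⟨i, j, h', j.is_lt, he⟩, ⟨j, i, h', i.is_lt, he.symm⟩]
  obtain ⟨q, hq⟩ : (j - i) ∣ K.factorial := Nat.dvd_factorial (by omega) (by omega)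
  have hstep : ∀ l : ℕ, w (y + (l * (j - i)) • d) = w y := by
    intro l
    induction l with
    | zero => simp
    | succ l ih =>
      rw [← ih]
      have := hdet _ _ hst (K - i + l * (j - i))
      convert this.symm using 2
      · obtain ⟨e, rfl⟩ := Nat.exists_eq_add_of_lt hij
        obtain ⟨e', he'⟩ := Nat.exists_eq_add_of_le (show i ≤ K by omega)
        rw [show i + e + 1 - i = e + 1 by omega, show K - i = e' by omega,
          show K • d = (i + e') • d by rw [← he']]
        module
      · obtain ⟨e', he'⟩ := Nat.exists_eq_add_of_le (show i ≤ K by omega)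
        rw [show K - i = e' by omega, show K • d = (i + e') • d by rw [← he']]
        module
  rw [hq, mul_comm]
  exact hstep q

end Translation

section GroupAlgebra

variable {G : Type*} [AddCommGroup G]

theorem mul_prod_sub_mem_of_sum_mul_pow_mem {ι R : Type*} [CommRing R] [DecidableEq ι]
    (I : Ideal R) (s : Finset ι) (a b : ι → R) (h : ∀ n : ℕ, ∑ i ∈ s, a i * b i ^ n ∈ I)
    {i₀ : ι} (hi₀ : i₀ ∈ s) : a i₀ * ∏ i ∈ s.erase i₀, (b i₀ - b i) ∈ I := by
  have key : ∀ E : Polynomial R, ∑ i ∈ s, a i * E.eval (b i) ∈ I := by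
    intro E
    induction E using Polynomial.induction_on' with
    | add p q hp hq => simpa [mul_add, Finset.sum_add_distrib] using I.add_mem hp hq
    | monomial n r =>
      have := I.mul_mem_left r (h n)
      rw [Finset.mul_sum] at this
      convert this using 2
      rw [Polynomial.eval_monomial]
      ring
  have := key (∏ i ∈ s.erase i₀, (Polynomial.X - Polynomial.C (b i)))
  rw [Finset.sum_eq_single_of_mem i₀ hi₀] at this
  · simpa [Polynomial.eval_prod] using this
  · intro i hi hne
    rw [Polynomial.eval_prod, Finset.prod_eq_zero (Finset.mem_erase.2 ⟨hne, hi⟩) (by simp),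
      mul_zero]

/-- Every monomial is algebraic modulo the ideal. -/
def MonomialsAlgebraic (J : Ideal (AddMonoidAlgebra ℂ G)) : Prop :=
  ∀ z : G, ∃ P : Polynomial ℂ, P ≠ 0 ∧ Polynomial.aeval (AddMonoidAlgebra.single z 1) P ∈ J

theorem MonomialsAlgebraic.of_mul_mem {J : Ideal (AddMonoidAlgebra ℂ G)}
    {a b : AddMonoidAlgebra ℂ G} (ha : MonomialsAlgebraic (J ⊔ Ideal.span {a}))
    (hb : MonomialsAlgebraic (J ⊔ Ideal.span {b})) (hab : a * b ∈ J) : MonomialsAlgebraic J := by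
  intro z
  obtain ⟨P, hP, hPJ⟩ := ha z
  obtain ⟨Q, hQ, hQJ⟩ := hb z
  refine ⟨P * Q, mul_ne_zero hP hQ, ?_⟩
  rw [map_mul]
  refine (show (J ⊔ Ideal.span {a}) * (J ⊔ Ideal.span {b}) ≤ J from ?_)
    (Ideal.mul_mem_mul hPJ hQJ)
  rw [Ideal.sup_mul, Ideal.mul_sup (Ideal.span {a}), Ideal.span_singleton_mul_span_singleton]
  refine sup_le Ideal.mul_le_left (sup_le Ideal.mul_le_right ?_)
  rwa [Ideal.span_singleton_le_iff_mem]

/-- The elements `h` such that every ideal containing `f` and `h` makes all monomials algebraic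
form a submonoid. -/
def algebraicCofactors (f : AddMonoidAlgebra ℂ G) : Submonoid (AddMonoidAlgebra ℂ G) where
  carrier := {h | ∀ J : Ideal (AddMonoidAlgebra ℂ G), f ∈ J → h ∈ J → MonomialsAlgebraic J}
  one_mem' := fun J _ h z => ⟨1, one_ne_zero, by simpa using h⟩
  mul_mem' := fun {a b} ha hb J hf hab => by
    refine .of_mul_mem (ha _ ?_ ?_) (hb _ ?_ ?_) hab
    exacts [Ideal.mem_sup_left hf, Ideal.mem_sup_right (Ideal.mem_span_singleton_self a),
      Ideal.mem_sup_left hf, Ideal.mem_sup_right (Ideal.mem_span_singleton_self b)]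

theorem mem_algebraicCofactors {f h : AddMonoidAlgebra ℂ G} :
    h ∈ algebraicCofactors f ↔
      ∀ J : Ideal (AddMonoidAlgebra ℂ G), f ∈ J → h ∈ J → MonomialsAlgebraic J := Iff.rfl

theorem single_mem_algebraicCofactors (f : AddMonoidAlgebra ℂ G) (z : G) :
    AddMonoidAlgebra.single z 1 ∈ algebraicCofactors f := by
  intro J _ hz
  have : (1 : AddMonoidAlgebra ℂ G) ∈ J := by
    have := J.mul_mem_left (AddMonoidAlgebra.single (-z) 1) hz
    simpa [AddMonoidAlgebra.single_mul_single, AddMonoidAlgebra.one_def] using this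
  exact fun z => ⟨1, one_ne_zero, by simpa using this⟩

theorem isIntegral_of_mul_eq_one {K B : Type*} [Field K] [CommRing B] [Algebra K B] {a b : B}
    (hab : a * b = 1) (ha : IsIntegral K a) : IsIntegral K b := by
  let _ : Invertible a := ⟨b, by rw [mul_comm, hab], hab⟩
  exact isAlgebraic_iff_isIntegral.1 (isAlgebraic_iff_isIntegral.2 ha).invOf

/-- The exponents whose monomials are integral modulo an ideal. -/
def integralExponents (J : Ideal (AddMonoidAlgebra ℂ G)) : AddSubgroup G where
  carrier := {z | IsIntegral ℂ (Ideal.Quotient.mk J (AddMonoidAlgebra.single z 1))}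
  zero_mem' := by
    simp only [Set.mem_ofPred_eq, ← AddMonoidAlgebra.one_def, map_one]
    exact isIntegral_one
  add_mem' := fun {a b} ha hb => by
    simp only [Set.mem_ofPred_eq] at *
    have := ha.mul hb
    rwa [← map_mul, AddMonoidAlgebra.single_mul_single, one_mul] at this
  neg_mem' := fun {a} ha => by
    simp only [Set.mem_ofPred_eq] at *
    refine isIntegral_of_mul_eq_one ?_ ha
    rw [← map_mul, AddMonoidAlgebra.single_mul_single, add_neg_cancel, one_mul,
      ← AddMonoidAlgebra.one_def, map_one]

theorem mem_integralExponents {J : Ideal (AddMonoidAlgebra ℂ G)} {z : G} :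
    z ∈ integralExponents J ↔
      IsIntegral ℂ (Ideal.Quotient.mk J (AddMonoidAlgebra.single z 1)) := Iff.rfl

theorem monomialsAlgebraic_of_integralExponents_eq_top {J : Ideal (AddMonoidAlgebra ℂ G)}
    (h : integralExponents J = ⊤) : MonomialsAlgebraic J := by
  intro z
  have hz : z ∈ integralExponents J := h ▸ AddSubgroup.mem_top z
  obtain ⟨P, hP, hz⟩ := isAlgebraic_iff_isIntegral.2 hz
  refine ⟨P, hP, ?_⟩
  rw [← Ideal.Quotient.eq_zero_iff_mem]
  have := Polynomial.aeval_algHom_apply (Ideal.Quotient.mkₐ ℂ J) (AddMonoidAlgebra.single z 1) P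
  rw [Ideal.Quotient.mkₐ_eq_mk] at this
  rw [← this, hz]

/-- A word over a finite alphabet with constant weighted sums over the translates of `F` is
periodic in every direction, as soon as all the binomials `X^w - 1` are algebraic cofactors of the
generating function of `F`. -/
theorem exists_period_of_cofactors [DecidableEq G] {F : Finset G} (hF : F.Nonempty)
    (hcof : ∀ z : G, z ≠ 0 → AddMonoidAlgebra.single z 1 - 1 ∈
      algebraicCofactors (∑ v ∈ F, AddMonoidAlgebra.single v 1)) [IsAddTorsionFree G]
    {k : ℕ} (w : G → Fin k)
    (hw : ∀ x y, ∑ v ∈ F, ((w (x + v) : ℕ) : ℤ) = ∑ v ∈ F, ((w (y + v) : ℕ) : ℤ)) (d : G) :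
    ∃ N : ℕ, N ≠ 0 ∧ ∀ x, w (x + N • d) = w x := by
  set f : G → ℤ := fun x => ((w (x + d) : ℕ) : ℤ) - ((w x : ℕ) : ℤ) with hf
  have hbound : ∀ x, |f x| ≤ k := by
    intro x
    have h1 := (w (x + d)).is_lt
    have h2 := (w x).is_lt
    rw [hf, abs_le]
    constructor <;> dsimp only <;> omega
  have hsum : ∀ x, ∑ v ∈ F, f (x + v) = 0 := by
    intro x
    simp only [hf, Finset.sum_sub_distrib, sub_eq_zero]
    rw [← hw (x + d) x]
    exact Finset.sum_congr rfl fun v _ => by rw [add_right_comm]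
  set r := (F.card * k).factorial with hr
  have hr0 : r ≠ 0 := Nat.factorial_ne_zero _
  have hdil : ∀ n : ℕ, ∀ x, ∑ v ∈ F, f (x + (1 + r * n) • v) = 0 := by
    intro n
    refine sum_translate_nsmul_eq_zero F id f hbound hsum _ (by omega) fun p hp hdvd => ?_
    by_contra! hle
    have : p ∣ r * n := ((Nat.dvd_factorial hp.pos hle)).mul_right n
    exact hp.one_lt.ne' (Nat.dvd_one.1 ((Nat.dvd_add_left this).1 hdvd))
  set J : Ideal (AddMonoidAlgebra ℂ G) := annihilatorIdeal (fun x => (f x : ℂ)) with hJ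
  have hmem : ∀ n : ℕ, ∑ v ∈ F, AddMonoidAlgebra.single v (1 : ℂ) *
      AddMonoidAlgebra.single (r • v) 1 ^ n ∈ J := by
    intro n
    have : ∑ v ∈ F, AddMonoidAlgebra.single v (1 : ℂ) *
      AddMonoidAlgebra.single (r • v) 1 ^ n =
        ∑ v ∈ F, AddMonoidAlgebra.single ((1 + r * n) • v) 1 := by
      refine Finset.sum_congr rfl fun v _ => ?_
      rw [AddMonoidAlgebra.single_pow, AddMonoidAlgebra.single_mul_single, one_pow, one_mul]
      congr 1
      module
    rw [this, mem_annihilatorIdeal]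
    ext x
    rw [translationHom_sum_single]
    rw [Pi.zero_apply]
    exact_mod_cast hdil n x
  obtain ⟨v₀, hv₀⟩ := hF
  have hFJ : ∑ v ∈ F, AddMonoidAlgebra.single v (1 : ℂ) ∈ J := by simpa using hmem 0
  have hprod := mul_prod_sub_mem_of_sum_mul_pow_mem J F _ _ hmem hv₀
  obtain ⟨P, hP, hPJ⟩ : ∃ P : Polynomial ℂ, P ≠ 0 ∧
      Polynomial.aeval (AddMonoidAlgebra.single d 1) P ∈ J := by
    refine mem_algebraicCofactors.1 (Submonoid.mul_mem _ (single_mem_algebraicCofactors _ _)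
      (Submonoid.prod_mem _ fun v hv => ?_)) J hFJ hprod d
    have hne : r • (v₀ - v) ≠ 0 :=
      smul_ne_zero hr0 (sub_ne_zero.2 (Finset.ne_of_mem_erase hv).symm)
    have := Submonoid.mul_mem _ (single_mem_algebraicCofactors (∑ v ∈ F, AddMonoidAlgebra.single v 1) (r • v))
      (hcof _ hne)
    rwa [mul_sub, mul_one, AddMonoidAlgebra.single_mul_single, one_mul, ← smul_add,
      add_sub_cancel] at this
  refine exists_period_of_annihilator w (fun a => ((a : ℕ) : ℂ))
    (fun a b hab => Fin.ext (Nat.cast_injective hab)) d (P * (Polynomial.X - 1))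
    (mul_ne_zero hP (Polynomial.X_sub_C_ne_zero 1)) ?_
  rw [mem_annihilatorIdeal, map_mul, map_mul, Module.End.mul_apply]
  rw [hJ, mem_annihilatorIdeal] at hPJ
  convert hPJ using 2
  ext x
  simp [hf, translationHom_single]

end GroupAlgebra

section Fibers

theorem eq_smul_add_smul {u v : ℤ × ℤ} (huv : u.2 * v.1 - u.1 * v.2 = 1) (x : ℤ × ℤ) :
    x = (v.1 * x.2 - v.2 * x.1) • u + (u.2 * x.1 - u.1 * x.2) • v := by
  ext
  · simp only [Prod.fst_add, Prod.smul_fst, smul_eq_mul]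
    linear_combination (-x.1) * huv
  · simp only [Prod.snd_add, Prod.smul_snd, smul_eq_mul]
    linear_combination (-x.2) * huv

theorem exists_primitive_smul {w : ℤ × ℤ} (hw : w ≠ 0) :
    ∃ (n : ℕ) (u v : ℤ × ℤ), n ≠ 0 ∧ w = n • u ∧ u.2 * v.1 - u.1 * v.2 = 1 := by
  have hg : 0 < Int.gcd w.1 w.2 := by
    rw [Int.gcd_pos_iff]
    by_contra! h
    exact hw (Prod.ext h.1 h.2)
  obtain ⟨a, b, hab, ha, hb⟩ := Int.exists_gcd_one hg
  refine ⟨Int.gcd w.1 w.2, (a, b), (Int.gcdB a b, -Int.gcdA a b), hg.ne', ?_, ?_⟩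
  · ext
    · rw [Prod.smul_fst, nsmul_eq_mul, mul_comm]
      exact ha
    · rw [Prod.smul_snd, nsmul_eq_mul, mul_comm]
      exact hb
  · have := Int.gcd_eq_gcd_ab a b
    rw [hab] at this
    push_cast at this
    dsimp only
    linear_combination -this

theorem IsConvexFigure.add_smul_mem {F : Finset (ℤ × ℤ)} (hF : IsConvexFigure F) {x u : ℤ × ℤ}
    (hx : x ∈ F) {i m : ℤ} (hi : 0 ≤ i) (him : i ≤ m) (hm : x + m • u ∈ F) : x + i • u ∈ F := by
  rcases hi.eq_or_lt with rfl | hi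
  · simpa using hx
  apply hF.2
  have hm0 : (0 : ℝ) < m := by exact_mod_cast hi.trans_le him
  have hi0 : (0 : ℝ) < i := by exact_mod_cast hi
  have him' : (i : ℝ) ≤ m := by exact_mod_cast him
  have h := (convex_convexHull ℝ (toR2 '' (F : Set (ℤ × ℤ))))
    (subset_convexHull ℝ _ (Set.mem_image_of_mem toR2 hx))
    (subset_convexHull ℝ _ (Set.mem_image_of_mem toR2 hm))
    (a := (m - i) / m) (b := i / m) (div_nonneg (by linarith) hm0.le) (by positivity)
    (by field_simp; ring)
  convert h using 1
  ext
  · simp [toR2]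
    field_simp
    ring
  · simp [toR2]
    field_simp
    ring

/-- The fibers of a convex figure along a primitive direction are segments. -/
theorem IsConvexFigure.exists_fiber_eq {F : Finset (ℤ × ℤ)} (hF : IsConvexFigure F)
    {u v : ℤ × ℤ} (huv : u.2 * v.1 - u.1 * v.2 = 1) (c : ℤ) :
    ∃ x₀ : ℤ × ℤ, F.filter (fun x => u.2 * x.1 - u.1 * x.2 = c) =
      (Finset.range (F.filter (fun x => u.2 * x.1 - u.1 * x.2 = c)).card).image
        (fun j => x₀ + j • u) := by
  set S := F.filter (fun x => u.2 * x.1 - u.1 * x.2 = c) with hS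
  rcases S.eq_empty_or_nonempty with h | h
  · exact ⟨0, by simp [h]⟩
  obtain ⟨x₀, hx₀, hmin⟩ := S.exists_min_image (fun x => v.1 * x.2 - v.2 * x.1) h
  obtain ⟨x₁, hx₁, hmax⟩ := S.exists_max_image (fun x => v.1 * x.2 - v.2 * x.1) h
  have hcoord : ∀ x ∈ S, ∀ y ∈ S,
      y = x + ((v.1 * y.2 - v.2 * y.1) - (v.1 * x.2 - v.2 * x.1)) • u := by
    intro x hx y hy
    have h1 := eq_smul_add_smul huv x
    have h2 := eq_smul_add_smul huv y
    rw [(Finset.mem_filter.1 hx).2] at h1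
    rw [(Finset.mem_filter.1 hy).2] at h2
    calc y = (v.1 * y.2 - v.2 * y.1) • u + c • v := h2
      _ = (v.1 * x.2 - v.2 * x.1) • u + c • v +
          ((v.1 * y.2 - v.2 * y.1) - (v.1 * x.2 - v.2 * x.1)) • u := by module
      _ = _ := by rw [← h1]
  have hu : u ≠ 0 := by
    rintro rfl
    simp at huv
  have hinj : Function.Injective (fun j : ℕ => x₀ + j • u) := by
    intro i j hij
    have := smul_left_injective ℤ hu (a₁ := (i : ℤ)) (a₂ := (j : ℤ))
      (by simpa using hij)
    exact_mod_cast this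
  set m := (v.1 * x₁.2 - v.2 * x₁.1) - (v.1 * x₀.2 - v.2 * x₀.1) with hm
  have hm0 : 0 ≤ m := sub_nonneg.2 (hmin x₁ hx₁)
  have key : S = (Finset.range (m.toNat + 1)).image (fun j => x₀ + j • u) := by
    ext y
    rw [Finset.mem_image]
    constructor
    · intro hy
      have h1 := hmin y hy
      have h2 := hmax y hy
      refine ⟨((v.1 * y.2 - v.2 * y.1) - (v.1 * x₀.2 - v.2 * x₀.1)).toNat,
        Finset.mem_range.2 (by omega), ?_⟩
      rw [← natCast_zsmul, Int.toNat_of_nonneg (by omega)]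
      exact (hcoord x₀ hx₀ y hy).symm
    · rintro ⟨j, hj, rfl⟩
      have hj := Finset.mem_range.1 hj
      refine Finset.mem_filter.2 ⟨?_, ?_⟩
      · have := hF.add_smul_mem (u := u) (Finset.mem_filter.1 hx₀).1 (i := j) (m := m)
          (by omega) (by omega) (by
            rw [hm, ← hcoord x₀ hx₀ x₁ hx₁]
            exact (Finset.mem_filter.1 hx₁).1)
        rwa [natCast_zsmul] at this
      · rw [← (Finset.mem_filter.1 hx₀).2]
        simp
        ring
  refine ⟨x₀, ?_⟩
  have hcard : S.card = m.toNat + 1 := by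
    conv_lhs => rw [key]
    rw [Finset.card_image_of_injective _ hinj, Finset.card_range]
  rw [hcard]
  exact key

theorem IsConvexFigure.sum_fiber {F : Finset (ℤ × ℤ)} (hF : IsConvexFigure F)
    {u v : ℤ × ℤ} (huv : u.2 * v.1 - u.1 * v.2 = 1) (c : ℤ) :
    ∃ x₀ : ℤ × ℤ, ∀ {M : Type} [AddCommMonoid M] (f : ℤ × ℤ → M),
      ∑ x ∈ F.filter (fun x => u.2 * x.1 - u.1 * x.2 = c), f x =
      ∑ j ∈ Finset.range (F.filter (fun x => u.2 * x.1 - u.1 * x.2 = c)).card,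
        f (x₀ + j • u) := by
  obtain ⟨x₀, hx₀⟩ := hF.exists_fiber_eq huv c
  refine ⟨x₀, fun f => ?_⟩
  conv_lhs => rw [hx₀]
  have hu : u ≠ 0 := by
    rintro rfl
    simp at huv
  rw [Finset.sum_image]
  intro i _ j _ hij
  have := smul_left_injective ℤ hu (a₁ := (i : ℤ)) (a₂ := (j : ℤ)) (by simpa using hij)
  exact_mod_cast this

end Fibers

section Rigidity

theorem single_sub_algebraMap_mem_algebraicCofactors {F : Finset (ℤ × ℤ)}
    (hF : IsConvexFigure F) {u v : ℤ × ℤ} (huv : u.2 * v.1 - u.1 * v.2 = 1)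
    (hu : URelativelyPrime F u) {ζ : ℂ} (hζ : ζ ≠ 0) :
    AddMonoidAlgebra.single u 1 - algebraMap ℂ (AddMonoidAlgebra ℂ (ℤ × ℤ)) ζ ∈
      algebraicCofactors (∑ x ∈ F, AddMonoidAlgebra.single x 1) := by
  intro J hFJ hζJ
  set L : ℤ × ℤ → ℤ := fun x => u.2 * x.1 - u.1 * x.2 with hL
  set K : ℤ × ℤ → ℤ := fun x => v.1 * x.2 - v.2 * x.1 with hK
  obtain ⟨M, hM⟩ : ∃ M : ℕ, ∀ x ∈ F, 0 ≤ K x + M ∧ 0 ≤ L x + M := by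
    refine ⟨F.sup fun x => (K x).natAbs ⊔ (L x).natAbs, fun x hx => ?_⟩
    have := Finset.le_sup (f := fun x => (K x).natAbs ⊔ (L x).natAbs) hx
    have h1 := le_sup_left.trans this
    have h2 := le_sup_right.trans this
    omega
  set P : Polynomial ℂ :=
    ∑ x ∈ F, Polynomial.C (ζ ^ (K x + M).toNat) * Polynomial.X ^ (L x + M).toNat with hP
  have htζ : Ideal.Quotient.mkₐ ℂ J (AddMonoidAlgebra.single u 1) =
      algebraMap ℂ (AddMonoidAlgebra ℂ (ℤ × ℤ) ⧸ J) ζ := by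
    rw [← sub_eq_zero, ← AlgHom.commutes (Ideal.Quotient.mkₐ ℂ J), ← map_sub]
    exact Ideal.Quotient.eq_zero_iff_mem.2 hζJ
  have hPJ : Polynomial.aeval (Ideal.Quotient.mkₐ ℂ J (AddMonoidAlgebra.single v 1)) P = 0 := by
    have h0 : Ideal.Quotient.mkₐ ℂ J (AddMonoidAlgebra.single (M • (u + v)) 1 *
        ∑ x ∈ F, AddMonoidAlgebra.single x 1) = 0 :=
      Ideal.Quotient.eq_zero_iff_mem.2 (J.mul_mem_left _ hFJ)
    rw [Finset.mul_sum, map_sum] at h0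
    rw [hP, map_sum, ← h0]
    refine Finset.sum_congr rfl fun x hx => ?_
    obtain ⟨h1, h2⟩ := hM x hx
    rw [map_mul, Polynomial.aeval_C, map_pow, map_pow, Polynomial.aeval_X, ← htζ, ← map_pow,
      ← map_pow, ← map_mul, AddMonoidAlgebra.single_pow, AddMonoidAlgebra.single_pow,
      AddMonoidAlgebra.single_mul_single, AddMonoidAlgebra.single_mul_single]
    simp only [one_pow, one_mul]
    congr 2
    conv_rhs => rw [eq_smul_add_smul huv x]
    rw [← natCast_zsmul u, ← natCast_zsmul v, Int.toNat_of_nonneg h1, Int.toNat_of_nonneg h2]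
    module
  have hP0 : P ≠ 0 := by
    intro hzero
    have hgeom : ∀ c ∈ F.image L,
        ∑ j ∈ Finset.range (F.filter fun x => L x = c).card, ζ ^ j = 0 := by
      intro c hc
      obtain ⟨x', hx', rfl⟩ := Finset.mem_image.1 hc
      have hcoeff : P.coeff (L x' + M).toNat = 0 := by rw [hzero, Polynomial.coeff_zero]
      simp only [hP, Polynomial.finsetSum_coeff, Polynomial.coeff_C_mul, Polynomial.coeff_X_pow,
        mul_ite, mul_one, mul_zero] at hcoeff
      rw [← Finset.sum_filter] at hcoeff
      have hfil : F.filter (fun x => (L x' + M).toNat = (L x + M).toNat) =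
          F.filter (fun x => L x = L x') := by
        refine Finset.filter_congr fun x hx => ?_
        have h1 := (hM x hx).2
        have h2 := (hM x' hx').2
        omega
      obtain ⟨x₀, hx₀⟩ := hF.sum_fiber huv (L x')
      rw [hfil, Finset.sum_congr rfl (g := fun x => ζ ^ (K x + M)) fun x hx => by
        rw [← zpow_natCast, Int.toNat_of_nonneg (hM x (Finset.mem_filter.1 hx).1).1], hx₀] at hcoeff
      have : ∀ j : ℕ, ζ ^ (K (x₀ + j • u) + M) = ζ ^ (K x₀ + M) * ζ ^ j := by
        intro j
        rw [← zpow_natCast, ← zpow_add₀ hζ]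
        congr 1
        simp only [hK, Prod.fst_add, Prod.snd_add, Prod.smul_fst, Prod.smul_snd]
        simp only [nsmul_eq_mul]
        linear_combination (j : ℤ) * huv
      simp only [this, ← Finset.mul_sum] at hcoeff
      exact (mul_eq_zero.1 hcoeff).resolve_left (zpow_ne_zero _ hζ)
    have hdvd : orderOf ζ ∣ 1 := by
      rw [← show _ = 1 from hu]
      refine Finset.dvd_gcd fun c hc => orderOf_dvd_of_pow_eq_one ?_
      have := geom_sum_mul ζ (F.filter fun x => L x = c).card
      rw [hgeom c hc, zero_mul] at this
      exact (sub_eq_zero.1 this.symm)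
    have hone : ζ = 1 := orderOf_eq_one_iff.1 (Nat.dvd_one.1 hdvd)
    obtain ⟨x, hx⟩ := hF.1
    have := hgeom (L x) (Finset.mem_image_of_mem L hx)
    simp only [hone, one_pow, Finset.sum_const, Finset.card_range, nsmul_eq_mul, mul_one,
      Nat.cast_eq_zero, Finset.card_eq_zero] at this
    exact Finset.notMem_empty x (this ▸ Finset.mem_filter.2 ⟨hx, rfl⟩)
  refine monomialsAlgebraic_of_integralExponents_eq_top ?_
  rw [eq_top_iff]
  intro x _
  rw [eq_smul_add_smul huv x]
  refine add_mem (zsmul_mem ?_ _) (zsmul_mem ?_ _)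
  · rw [mem_integralExponents, ← Ideal.Quotient.mkₐ_eq_mk ℂ, htζ]
    exact isIntegral_algebraMap
  · exact isAlgebraic_iff_isIntegral.1 ⟨P, hP0, hPJ⟩

theorem RelativelyPrime.single_sub_one_mem_algebraicCofactors {F : Finset (ℤ × ℤ)}
    (hrel : RelativelyPrime F) (hF : IsConvexFigure F) {z : ℤ × ℤ} (hz : z ≠ 0) :
    AddMonoidAlgebra.single z 1 - 1 ∈
      algebraicCofactors (∑ x ∈ F, AddMonoidAlgebra.single x (1 : ℂ)) := by
  obtain ⟨n, u, v, hn, rfl, huv⟩ := exists_primitive_smul hz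
  have hu : u ≠ 0 := by
    rintro rfl
    simp at huv
  have := congrArg (Polynomial.aeval (AddMonoidAlgebra.single u (1 : ℂ)))
    (Polynomial.X_pow_sub_one_eq_prod (Nat.pos_of_ne_zero hn) (Complex.isPrimitiveRoot_exp n hn))
  rw [map_sub, map_pow, Polynomial.aeval_X, map_one, AddMonoidAlgebra.single_pow, one_pow,
    map_prod] at this
  rw [this]
  refine Submonoid.prod_mem _ fun ζ hζ => ?_
  rw [map_sub, Polynomial.aeval_X, Polynomial.aeval_C]
  refine single_sub_algebraMap_mem_algebraicCofactors hF huv (hrel u hu) ?_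
  rintro rfl
  rw [Polynomial.mem_nthRootsFinset (Nat.pos_of_ne_zero hn), zero_pow hn] at hζ
  exact zero_ne_one hζ

theorem AbelianComplexityOne.sum_eq {F : Finset (ℤ × ℤ)} {k : ℕ} {w : ℤ × ℤ → Fin k}
    (hw : AbelianComplexityOne F w) (x y : ℤ × ℤ) :
    ∑ v ∈ F, ((w (x + v) : ℕ) : ℤ) = ∑ v ∈ F, ((w (y + v) : ℕ) : ℤ) := by
  have key : ∀ x, ∑ v ∈ F, ((w (x + v) : ℕ) : ℤ) =
      ∑ a : Fin k, ((F.filter fun v => w (v + x) = a).card : ℤ) * (a : ℕ) := by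
    intro x
    rw [← Finset.sum_fiberwise F (fun v => w (v + x))]
    refine Finset.sum_congr rfl fun a _ => ?_
    rw [Finset.sum_congr rfl (g := fun _ => ((a : ℕ) : ℤ)) fun v hv => by
      rw [add_comm x v, (Finset.mem_filter.1 hv).2]]
    simp
  rw [key, key]
  exact Finset.sum_congr rfl fun a _ => by rw [hw a x y]

theorem RelativelyPrime.abelianRigid {F : Finset (ℤ × ℤ)} (hrel : RelativelyPrime F)
    (hF : IsConvexFigure F) : AbelianRigid F := by
  intro k _ w hw
  have hper := exists_period_of_cofactors hF.1
    (fun z hz => hrel.single_sub_one_mem_algebraicCofactors hF hz) w hw.sum_eq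
  obtain ⟨N, hN, hNw⟩ := hper (1, 0)
  obtain ⟨M, hM, hMw⟩ := hper (0, 1)
  refine ⟨_, _, ?_, hNw, hMw⟩
  rw [LinearIndependent.pair_iff]
  intro s t hst
  simpa [hN, hM] using hst

theorem FullyPeriodic.exists_forall_zsmul {A : Type*} {w : ℤ × ℤ → A} (hw : FullyPeriodic w) :
    ∃ D : ℤ, D ≠ 0 ∧ ∀ z x, w (x + D • z) = w x := by
  obtain ⟨p, q, hpq, hp, hq⟩ := hw
  have hp' : ∀ (n : ℤ) x, w (x + n • p) = w x := fun n => by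
    have : Function.Periodic w p := hp
    exact this.zsmul n
  have hq' : ∀ (n : ℤ) x, w (x + n • q) = w x := fun n => by
    have : Function.Periodic w q := hq
    exact this.zsmul n
  refine ⟨p.1 * q.2 - p.2 * q.1, fun hD => ?_, fun z x => ?_⟩
  · rw [LinearIndependent.pair_iff] at hpq
    have h1 := hpq q.2 (-p.2) (by
      ext
      · simp
        linear_combination hD
      · simp
        ring)
    have h2 := hpq q.1 (-p.1) (by
      ext
      · simp
        ring
      · simp
        linear_combination -hD)
    have hp0 : p = 0 := Prod.ext (by simpa using h2.2) (by simpa using h1.2)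
    have := hpq 1 0 (by simp [hp0])
    exact one_ne_zero this.1
  · have : (p.1 * q.2 - p.2 * q.1) • z =
        (z.1 * q.2 - z.2 * q.1) • p + (z.2 * p.1 - z.1 * p.2) • q := by
      ext
      · simp
        ring
      · simp
        ring
    rw [this, ← add_assoc, hq', hp']

theorem card_filter_range_add_emod_eq {g n : ℕ} (hg : 0 < g) (hn : g ∣ n) (b a : ℤ) :
    ((Finset.range n).filter fun j : ℕ => (b + j) % g = a % g).card = n / g := by
  have hg' : (0 : ℤ) < g := by exact_mod_cast hg
  have h := Nat.count_modEq_card n hg ((a - b) % g).toNat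
  rw [Nat.count_eq_card_filter_range, Nat.mod_eq_zero_of_dvd hn, if_neg (Nat.not_lt_zero _),
    add_zero] at h
  rw [← h]
  congr 1
  refine Finset.filter_congr fun j _ => ?_
  rw [← Int.natCast_modEq_iff, Int.toNat_of_nonneg (Int.emod_nonneg _ hg'.ne')]
  change b + j ≡ a [ZMOD g] ↔ _
  have hmod : (a - b) % g ≡ a - b [ZMOD g] := Int.mod_modEq _ _
  constructor
  · intro h
    refine (Int.ModEq.trans ?_ (h.sub_right b)).trans hmod.symm
    rw [add_sub_cancel_left]
  · intro h
    have := (h.trans hmod).add_left b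
    rwa [add_sub_cancel] at this

theorem AbelianRigid.relativelyPrime {F : Finset (ℤ × ℤ)} (hrig : AbelianRigid F)
    (hF : IsConvexFigure F) : RelativelyPrime F := by
  intro u' hu'
  obtain ⟨m, u, v, hm, rfl, huv⟩ := exists_primitive_smul hu'
  by_contra hne
  set g := (F.image (fun x => (m • u).2 * x.1 - (m • u).1 * x.2)).gcd
    (fun c => (F.filter (fun x => (m • u).2 * x.1 - (m • u).1 * x.2 = c)).card) with hg
  have hscale : ∀ x : ℤ × ℤ, (m • u).2 * x.1 - (m • u).1 * x.2 =
      m * (u.2 * x.1 - u.1 * x.2) := by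
    intro x
    simp only [Prod.smul_fst, Prod.smul_snd]
    simp only [nsmul_eq_mul]
    ring
  have hdvd : ∀ c : ℤ, g ∣ (F.filter (fun x => u.2 * x.1 - u.1 * x.2 = c)).card := by
    intro c
    rcases (F.filter (fun x => u.2 * x.1 - u.1 * x.2 = c)).eq_empty_or_nonempty with h | ⟨x, hx⟩
    · simp [h]
    · obtain ⟨hxF, hxc⟩ := Finset.mem_filter.1 hx
      have : (m : ℤ) * c ∈ F.image (fun x => (m • u).2 * x.1 - (m • u).1 * x.2) :=
        Finset.mem_image.2 ⟨x, hxF, by rw [hscale, hxc]⟩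
      have h2 := Finset.gcd_dvd (f := fun c =>
        (F.filter (fun x => (m • u).2 * x.1 - (m • u).1 * x.2 = c)).card) this
      rwa [Finset.filter_congr (q := fun x => u.2 * x.1 - u.1 * x.2 = c) fun y _ => by
        rw [hscale, mul_right_inj' (by exact_mod_cast hm)]] at h2
  have hg0 : g ≠ 0 := by
    obtain ⟨x, hx⟩ := hF.1
    intro h0
    have := hdvd (u.2 * x.1 - u.1 * x.2)
    rw [h0, zero_dvd_iff, Finset.card_eq_zero] at this
    exact Finset.notMem_empty x (this ▸ Finset.mem_filter.2 ⟨hx, rfl⟩)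
  have hg1 : g ≠ 1 := hne
  set s : ℤ × ℤ → ℤ := fun x =>
    (v.1 * x.2 - v.2 * x.1) + if u.2 * x.1 - u.1 * x.2 = 0 then 1 else 0 with hs
  have hgpos : (0 : ℤ) < g := by omega
  let w : ℤ × ℤ → Fin g := fun x => ⟨(s x % g).toNat, by
    have := Int.emod_nonneg (s x) hgpos.ne'
    have := Int.emod_lt_of_pos (s x) hgpos
    omega⟩
  have hwiff : ∀ x (a : Fin g), w x = a ↔ s x % g = (a : ℤ) % g := by
    intro x a
    have h1 := Int.emod_nonneg (s x) hgpos.ne'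
    have h2 := a.is_lt
    rw [Int.emod_eq_of_lt (a := (a : ℤ)) (by omega) (by omega), Fin.ext_iff]
    simp only [w]
    omega
  have hw : AbelianComplexityOne F w := by
    have key : ∀ (a : Fin g) (t : ℤ × ℤ), (F.filter fun x => w (x + t) = a).card =
        ∑ c ∈ F.image (fun x => u.2 * x.1 - u.1 * x.2),
          (F.filter (fun x => u.2 * x.1 - u.1 * x.2 = c)).card / g := by
      intro a t
      rw [Finset.card_filter, ← Finset.sum_fiberwise_of_maps_to
        (g := fun x : ℤ × ℤ => u.2 * x.1 - u.1 * x.2) fun x hx => Finset.mem_image_of_mem _ hx]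
      refine Finset.sum_congr rfl fun c _ => ?_
      obtain ⟨x₀, hx₀⟩ := hF.sum_fiber huv c
      rw [Finset.sum_congr rfl (g := fun x => if ((v.1 * (x + t).2 - v.2 * (x + t).1) +
          if c + (u.2 * t.1 - u.1 * t.2) = 0 then 1 else 0) % (g : ℤ) = (a : ℤ) % g
          then 1 else 0) fun x hx => ?_, hx₀, ← Finset.card_filter]
      · rw [← card_filter_range_add_emod_eq (Nat.pos_of_ne_zero hg0) (hdvd c)
          ((v.1 * (x₀ + t).2 - v.2 * (x₀ + t).1) +
          if c + (u.2 * t.1 - u.1 * t.2) = 0 then 1 else 0) a]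
        congr 1
        refine Finset.filter_congr fun j _ => ?_
        have : v.1 * (x₀ + j • u + t).2 - v.2 * (x₀ + j • u + t).1 =
            v.1 * (x₀ + t).2 - v.2 * (x₀ + t).1 + j := by
          simp only [Prod.fst_add, Prod.snd_add, Prod.smul_fst, Prod.smul_snd]
          simp only [nsmul_eq_mul]
          linear_combination (j : ℤ) * huv
        rw [this, add_right_comm]
      · have : u.2 * (x + t).1 - u.1 * (x + t).2 = c + (u.2 * t.1 - u.1 * t.2) := by
          rw [← (Finset.mem_filter.1 hx).2, Prod.fst_add, Prod.snd_add]
          ring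
        simp only [hwiff, hs, this]
    intro a t t'
    rw [key, key]
  obtain ⟨D, hD, hper⟩ := (hrig g (Nat.pos_of_ne_zero hg0) w hw).exists_forall_zsmul
  have h1 := hper v 0
  rw [hwiff] at h1
  have h2 : s (0 + D • v) = 0 := by
    have e1 : u.2 * (0 + D • v).1 - u.1 * (0 + D • v).2 = D := by
      simp
      linear_combination D * huv
    have e2 : v.1 * (0 + D • v).2 - v.2 * (0 + D • v).1 = 0 := by
      simp
      ring
    simp only [hs, e1, e2, if_neg hD, add_zero]
  have h3 : s 0 = 1 := by simp [hs]
  have h4 : ((w 0 : ℕ) : ℤ) = 1 := by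
    have h5 : (1 : ℤ) % g = 1 := Int.emod_eq_of_lt (by omega) (by omega)
    simp only [w, h3, h5]
    rfl
  rw [h2, h4, Int.zero_emod, Int.emod_eq_of_lt (by omega) (by omega)] at h1
  exact zero_ne_one h1

end Rigidity

/-- Let F ⊆ ℤ² be a convex figure. Then F is relatively prime if and only if
F is abelian rigid. -/
theorem stmt7 (F : Finset (ℤ × ℤ)) (hconv : IsConvexFigure F) :
    RelativelyPrime F ↔ AbelianRigid F := by
  exact ⟨fun h => h.abelianRigid hconv, fun h => h.relativelyPrime hconv⟩
end

section
/- Let g : ℤ² → ℤ be finitely supported and not identically zero, and let G = ∑_{x ∈ supp g} g(x)·x^x ∈ R be the associated Laurent polynomial. Suppose there exist v ∈ ℤ² with v ≠ 0 and an integer n ≥ 1 such that l(v,n) divides G in R. Then there exist k ≥ 1 and a word w : ℤ² → Fin k which is not fully periodic and such that for every letter a ∈ Fin k the weighted count t ↦ ∑_{x ∈ supp g with w(x+t) = a} g(x) does not depend on t ∈ ℤ². -/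
/-- The correlation of a Laurent polynomial with `f`, as an additive map: `∑ c_x x^x` is sent to
`∑ c_x f (x + t)`. -/
noncomputable def correlation (f : ℤ × ℤ → ℤ) (t : ℤ × ℤ) : LaurentR →+ ℤ :=
  (Finsupp.liftAddHom fun x => AddMonoidHom.mulRight (f (x + t))).comp
    AddMonoidAlgebra.coeffAddEquiv.toAddMonoidHom

lemma correlation_single (f : ℤ × ℤ → ℤ) (t x : ℤ × ℤ) (c : ℤ) :
    correlation f t (AddMonoidAlgebra.single x c) = c * f (x + t) := by
  simp [correlation, AddMonoidAlgebra.coeffAddEquiv]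

/-- If the sums of `f` along all translates of `0, v, …, n • v` equal `C`, then the correlation of
`f` with a multiple of `stronglyLinear v n` is constant. -/
lemma exists_correlation_stronglyLinear_mul_eq {f : ℤ × ℤ → ℤ} {v : ℤ × ℤ} {n : ℕ} {C : ℤ}
    (hf : ∀ x, ∑ i ∈ Finset.range (n + 1), f (x + i • v) = C) (H : LaurentR) :
    ∃ K : ℤ, ∀ t, correlation f t (stronglyLinear v n * H) = K := by
  induction H using AddMonoidAlgebra.induction_linear with
  | zero => exact ⟨0, fun t => by simp⟩
  | add A B hA hB =>
    obtain ⟨K, hK⟩ := hA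
    obtain ⟨L, hL⟩ := hB
    exact ⟨K + L, fun t => by rw [mul_add, map_add, hK, hL]⟩
  | single y b =>
    refine ⟨b * C, fun t => ?_⟩
    rw [stronglyLinear, Finset.sum_mul, map_sum, ← hf (y + t), Finset.mul_sum]
    refine Finset.sum_congr rfl fun i _ => ?_
    rw [mono, AddMonoidAlgebra.single_mul_single, correlation_single, one_mul]
    congr 2
    abel

/-- Every residue class is hit equally often by all windows of length `n + 1`. -/
lemma sum_range_indicator_zmod (n : ℕ) (a : ZMod (n + 1)) (m : ℤ) :
    ∑ i ∈ Finset.range (n + 1), (if ((m + i : ℤ) : ZMod (n + 1)) = a then (1 : ℤ) else 0) =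
      ∑ i ∈ Finset.range (n + 1), (if ((i : ℤ) : ZMod (n + 1)) = a then (1 : ℤ) else 0) := by
  have key : Function.Periodic (fun m : ℤ => ∑ i ∈ Finset.range (n + 1),
      (if ((m + i : ℤ) : ZMod (n + 1)) = a then (1 : ℤ) else 0)) 1 := by
    intro m
    simp only
    rw [Finset.sum_range_succ, Finset.sum_range_succ']
    have h : ((m + 1 + (n : ℤ) : ℤ) : ZMod (n + 1)) = ((m + ((0 : ℕ) : ℤ) : ℤ) : ZMod (n + 1)) := by
      have := ZMod.natCast_self (n + 1)
      push_cast at this ⊢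
      linear_combination this
    rw [h]
    congr 1
    refine Finset.sum_congr rfl fun i _ => ?_
    rw [show m + 1 + (i : ℤ) = m + ((i + 1 : ℕ) : ℤ) by push_cast; ring]
  simpa using key.int_mul_eq m

/-- An integer-valued function increasing by one along `v`, with the line through `0` in direction
`v` shifted against all the others. -/
def shiftedPhase (v x : ℤ × ℤ) : ℤ :=
  (v.1 * x.1 + v.2 * x.2) / (v.1 ^ 2 + v.2 ^ 2) + if v.1 * x.2 - v.2 * x.1 = 0 then 1 else 0

lemma sq_add_sq_ne_zero_of_ne_zero {v : ℤ × ℤ} (hv : v ≠ 0) : v.1 ^ 2 + v.2 ^ 2 ≠ 0 := by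
  intro h
  apply hv
  ext
  · exact pow_eq_zero_iff two_ne_zero |>.1 (by nlinarith [sq_nonneg v.1, sq_nonneg v.2])
  · exact pow_eq_zero_iff two_ne_zero |>.1 (by nlinarith [sq_nonneg v.1, sq_nonneg v.2])

lemma shiftedPhase_add_nsmul {v : ℤ × ℤ} (hv : v ≠ 0) (x : ℤ × ℤ) (i : ℕ) :
    shiftedPhase v (x + i • v) = shiftedPhase v x + i := by
  have h1 : v.1 * (x + i • v).1 + v.2 * (x + i • v).2 =
      (v.1 * x.1 + v.2 * x.2) + i * (v.1 ^ 2 + v.2 ^ 2) := by simp; ring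
  have h2 : v.1 * (x + i • v).2 - v.2 * (x + i • v).1 = v.1 * x.2 - v.2 * x.1 := by simp; ring
  rw [shiftedPhase, h1, h2, Int.add_mul_ediv_right _ _ (sq_add_sq_ne_zero_of_ne_zero hv),
    shiftedPhase]
  ring

/-- Every period of the shifted phase modulo `n + 1` is parallel to `v`. -/
lemma det_eq_zero_of_periodic_shiftedPhase {v : ℤ × ℤ} (hv : v ≠ 0) {n : ℕ} (hn : 1 ≤ n)
    {p : ℤ × ℤ}
    (hp : Function.Periodic (fun x => (shiftedPhase v x : ZMod (n + 1))) p) :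
    v.1 * p.2 - v.2 * p.1 = 0 := by
  by_contra hdet
  have hc := sq_add_sq_ne_zero_of_ne_zero hv
  have : Fact (1 < n + 1) := ⟨by omega⟩
  set N : ℤ := (n + 1 : ℤ) * (v.1 ^ 2 + v.2 ^ 2) with hN
  have hN0 : N ≠ 0 := mul_ne_zero (by omega) hc
  have h := (hp.zsmul N).eq
  have h1 : shiftedPhase v (N • p) = (v.1 * p.1 + v.2 * p.2) * (n + 1) := by
    have e1 : v.1 * (N • p).1 + v.2 * (N • p).2 =
        (v.1 * p.1 + v.2 * p.2) * (n + 1) * (v.1 ^ 2 + v.2 ^ 2) := by simp [hN]; ring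
    have e2 : v.1 * (N • p).2 - v.2 * (N • p).1 = N * (v.1 * p.2 - v.2 * p.1) := by simp; ring
    rw [shiftedPhase, e1, e2, Int.mul_ediv_cancel _ hc, if_neg (mul_ne_zero hN0 hdet), add_zero]
  have h2 : shiftedPhase v 0 = 1 := by simp [shiftedPhase]
  have h3 : ((n : ZMod (n + 1)) + 1) = 0 := by exact_mod_cast ZMod.natCast_self (n + 1)
  simp only [h1, h2] at h
  push_cast at h
  rw [h3, mul_zero] at h
  exact zero_ne_one h

lemma not_linearIndependent_of_det_eq_zero {v p q : ℤ × ℤ} (hv : v ≠ 0)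
    (hp : v.1 * p.2 - v.2 * p.1 = 0) (hq : v.1 * q.2 - v.2 * q.1 = 0) :
    ¬ LinearIndependent ℤ ![p, q] := by
  intro h
  have hc := sq_add_sq_ne_zero_of_ne_zero hv
  have hdet : p.1 * q.2 - p.2 * q.1 = 0 := by
    refine (mul_eq_zero.1 ?_).resolve_left hc
    linear_combination (v.1 * p.1 + v.2 * p.2) * hq - (v.1 * q.1 + v.2 * q.2) * hp
  rw [LinearIndependent.pair_iff] at h
  have h1 := (h q.1 (-p.1) (by ext <;> simp <;> linarith)).2
  have h2 := (h q.2 (-p.2) (by ext <;> simp <;> linarith)).2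
  have hp0 : p = 0 := by ext <;> simp <;> omega
  exact one_ne_zero (h 1 0 (by simp [hp0])).1

lemma not_fullyPeriodic_shiftedPhase {v : ℤ × ℤ} (hv : v ≠ 0) {n : ℕ} (hn : 1 ≤ n) :
    ¬ FullyPeriodic (fun x => (shiftedPhase v x : ZMod (n + 1))) := by
  rintro ⟨p, q, hpq, hp, hq⟩
  exact not_linearIndependent_of_det_eq_zero hv (det_eq_zero_of_periodic_shiftedPhase hv hn hp)
    (det_eq_zero_of_periodic_shiftedPhase hv hn hq) hpq


/-- Let g : ℤ² → ℤ be finitely supported and not identically zero, with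
associated Laurent polynomial G = ∑_{x ∈ supp g} g(x)·x^x. If some nontrivial strongly
linear polynomial l(v,n) divides G, then there exist k ≥ 1 and a word w : ℤ² → Fin k
which is not fully periodic such that for every letter a the weighted count
t ↦ ∑_{x ∈ supp g, w(x+t) = a} g(x) does not depend on t ∈ ℤ². -/
theorem stmt8 (g : (ℤ × ℤ) →₀ ℤ) (hg : g ≠ 0)
    (G : LaurentR) (hG : G = ∑ x ∈ g.support, AddMonoidAlgebra.single x (g x))
    (hdvd : ∃ (v : ℤ × ℤ) (n : ℕ), v ≠ 0 ∧ 1 ≤ n ∧ stronglyLinear v n ∣ G) :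
    ∃ (k : ℕ), 1 ≤ k ∧ ∃ w : ℤ × ℤ → Fin k, ¬ FullyPeriodic w ∧
      ∀ (a : Fin k) (t t' : ℤ × ℤ),
        ∑ x ∈ g.support.filter (fun x => w (x + t) = a), g x =
        ∑ x ∈ g.support.filter (fun x => w (x + t') = a), g x := by
  obtain ⟨v, n, hv, hn, H, hH⟩ := hdvd
  refine ⟨n + 1, by omega, fun x => (shiftedPhase v x : ZMod (n + 1)),
    not_fullyPeriodic_shiftedPhase hv hn, fun (a : ZMod (n + 1)) => ?_⟩
  obtain ⟨K, hK⟩ := exists_correlation_stronglyLinear_mul_eq (v := v) (n := n)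
    (f := fun x => if (shiftedPhase v x : ZMod (n + 1)) = a then 1 else 0)
    (fun x => by
      simp only [shiftedPhase_add_nsmul hv]
      exact sum_range_indicator_zmod n a (shiftedPhase v x)) H
  have key : ∀ t : ℤ × ℤ, ∑ x ∈ g.support with (shiftedPhase v (x + t) : ZMod (n + 1)) = a, g x
      = K := by
    intro t
    rw [← hK t, ← hH, hG, map_sum, Finset.sum_filter]
    refine Finset.sum_congr rfl fun x _ => ?_
    rw [correlation_single]
    simp
  intro t t'
  exact (key t).trans (key t').symm
end

section
/- Let u, v ∈ ℤ² be a basis of ℤ² (i.e., every z ∈ ℤ² can be written as z = a·u + b·v with integers a, b) and let F ⊆ ℤ² be a convex figure. Then there exist an integer n ≥ 0, functions l, r : {0,1,…,n} → ℤ with l(0) < r(0), l(n) < r(n) and l(i) ≤ r(i) for all 0 ≤ i ≤ n, and a translation vector τ ∈ ℤ² such that F = {τ + i·u + j·v : 0 ≤ i ≤ n, l(i) ≤ j < r(i)}. -/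
/-- A convex figure contains every lattice point `z + p • v` between two of its points
`z` and `z + q • v`. -/
theorem IsConvexFigure.add_smul_mem_s9 {F : Finset (ℤ × ℤ)} (hF : IsConvexFigure F)
    {z v : ℤ × ℤ} {p q : ℤ} (hz : z ∈ F) (hw : z + q • v ∈ F) (hp : 0 ≤ p) (hpq : p ≤ q) :
    z + p • v ∈ F := by
  rcases hp.eq_or_lt with rfl | hp
  · simpa using hz
  have hq : (0 : ℝ) < q := by exact_mod_cast hp.trans_le hpq
  have hpq' : (p : ℝ) ≤ q := by exact_mod_cast hpq
  have hp' : (0 : ℝ) ≤ p := by exact_mod_cast hp.le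
  apply hF.2
  apply segment_subset_convexHull (Set.mem_image_of_mem toR2 hz) (Set.mem_image_of_mem toR2 hw)
  refine ⟨1 - p / q, p / q, ?_, by positivity, by ring, ?_⟩
  · rw [sub_nonneg, div_le_one hq]
    exact hpq'
  · ext <;> simp [toR2] <;> field_simp <;> ring

/-- A finite order-connected set of integers is a half-open interval. -/
theorem Finset.exists_mem_iff_le_lt (S : Finset ℤ)
    (hS : ∀ a ∈ S, ∀ b ∈ S, ∀ m, a ≤ m → m ≤ b → m ∈ S) :
    ∃ l r : ℤ, l ≤ r ∧ ∀ j, j ∈ S ↔ l ≤ j ∧ j < r := by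
  rcases S.eq_empty_or_nonempty with rfl | hne
  · exact ⟨0, 0, le_rfl, fun j => by simp⟩
  · refine ⟨S.min' hne, S.max' hne + 1, ?_, fun j => ⟨fun hj => ?_, fun hj => ?_⟩⟩
    · have := S.min'_le_max' hne
      lia
    · have := S.min'_le j hj
      have := S.le_max' j hj
      lia
    · exact hS _ (S.min'_mem hne) _ (S.max'_mem hne) j hj.1 (by lia)

/-- Coordinates with respect to a generating pair of `ℤ × ℤ`. -/
theorem exists_coordinates (u v : ℤ × ℤ)
    (hbasis : ∀ z : ℤ × ℤ, ∃ a b : ℤ, z = a • u + b • v) :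
    ∃ α β : ℤ × ℤ → ℤ, (∀ z, z = α z • u + β z • v) ∧
      ∀ a b : ℤ, α (a • u + b • v) = a ∧ β (a • u + b • v) = b := by
  obtain ⟨u₁, u₂⟩ := u
  obtain ⟨v₁, v₂⟩ := v
  obtain ⟨a, b, h₁⟩ := hbasis (1, 0)
  obtain ⟨c, d, h₂⟩ := hbasis (0, 1)
  simp only [Prod.smul_mk, smul_eq_mul, Prod.mk_add_mk, Prod.mk.injEq] at h₁ h₂
  have hdet : (a * d - b * c) * (u₁ * v₂ - u₂ * v₁) = 1 := by
    linear_combination -(c * u₂ + d * v₂) * h₁.1 - h₂.2 + (c * u₁ + d * v₁) * h₁.2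
  set e := a * d - b * c
  refine ⟨fun z => e * (z.1 * v₂ - z.2 * v₁), fun z => e * (u₁ * z.2 - u₂ * z.1),
    fun z => ?_, fun a b => ⟨?_, ?_⟩⟩
  · ext <;> simp
    · linear_combination -z.1 * hdet
    · linear_combination -z.2 * hdet
  · simp
    linear_combination a * hdet
  · simp
    linear_combination b * hdet

/-- Let u, v be a basis of ℤ² and F ⊆ ℤ² a convex figure. Then there exist
n ≥ 0, functions l, r : {0,…,n} → ℤ with l(0) < r(0), l(n) < r(n), l(i) ≤ r(i) for all
0 ≤ i ≤ n, and a translation vector τ such that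
F = {τ + i·u + j·v : 0 ≤ i ≤ n, l(i) ≤ j < r(i)}. -/
theorem stmt9 (u v : ℤ × ℤ)
    (hbasis : ∀ z : ℤ × ℤ, ∃ a b : ℤ, z = a • u + b • v)
    (F : Finset (ℤ × ℤ)) (hconv : IsConvexFigure F) :
    ∃ (n : ℕ) (l r : ℕ → ℤ) (τ : ℤ × ℤ),
      l 0 < r 0 ∧ l n < r n ∧ (∀ i ≤ n, l i ≤ r i) ∧
      ∀ z : ℤ × ℤ, z ∈ F ↔
        ∃ (i : ℕ) (j : ℤ), i ≤ n ∧ l i ≤ j ∧ j < r i ∧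
          z = τ + (i : ℤ) • u + j • v := by
  obtain ⟨α, β, hdecomp, hcoord⟩ := exists_coordinates u v hbasis
  have hfibre (k : ℤ) : ∃ l r : ℤ, l ≤ r ∧ ∀ j, k • u + j • v ∈ F ↔ l ≤ j ∧ j < r := by
    obtain ⟨l, r, hlr, h⟩ := ((F.filter (α · = k)).image β).exists_mem_iff_le_lt (by
      simp only [Finset.mem_image, Finset.mem_filter]
      rintro _ ⟨z, ⟨hz, hzk⟩, rfl⟩ _ ⟨w, ⟨hw, hwk⟩, rfl⟩ m hzm hmw
      refine ⟨k • u + m • v, ⟨?_, (hcoord k m).1⟩, (hcoord k m).2⟩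
      have hm : k • u + m • v = z + (m - β z) • v := by
        conv_rhs => enter [1]; rw [hdecomp z]
        rw [hzk]
        module
      have hw' : w = z + (β w - β z) • v := by
        conv_lhs => rw [hdecomp w]
        conv_rhs => enter [1]; rw [hdecomp z]
        rw [hzk, hwk]
        module
      rw [hm]
      exact hconv.add_smul_mem_s9 hz (hw' ▸ hw) (by lia) (by lia))
    refine ⟨l, r, hlr, fun j => ?_⟩
    rw [← h]
    simp only [Finset.mem_image, Finset.mem_filter]
    constructor
    · exact fun hj => ⟨_, ⟨hj, (hcoord k j).1⟩, (hcoord k j).2⟩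
    · rintro ⟨z, ⟨hz, rfl⟩, rfl⟩
      rwa [← hdecomp z]
  choose l r hlr hmem using hfibre
  have hlt {z : ℤ × ℤ} (hz : z ∈ F) : l (α z) ≤ β z ∧ β z < r (α z) := by
    rw [← hmem, ← hdecomp]
    exact hz
  obtain ⟨x, hxF, hx⟩ := F.exists_min_image α hconv.1
  obtain ⟨y, hyF, hy⟩ := F.exists_max_image α hconv.1
  have hxy : α x + ((α y - α x).toNat : ℤ) = α y := by
    have := hx y hyF
    lia
  refine ⟨(α y - α x).toNat, fun i => l (α x + i), fun i => r (α x + i), α x • u,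
    ?_, ?_, fun i _ => hlr _, fun z => ⟨fun hz => ?_, ?_⟩⟩
  · simpa using (hlt hxF).1.trans_lt (hlt hxF).2
  · simpa only [hxy] using (hlt hyF).1.trans_lt (hlt hyF).2
  · have hxz := hx z hz
    have hzy := hy z hz
    have hi : α x + ((α z - α x).toNat : ℤ) = α z := by lia
    refine ⟨(α z - α x).toNat, β z, by lia, ?_, ?_, ?_⟩
    · simpa only [hi] using (hlt hz).1
    · simpa only [hi] using (hlt hz).2
    · rw [← add_smul, hi]
      exact hdecomp z
  · rintro ⟨i, j, -, hl, hr, rfl⟩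
    rw [← add_smul]
    exact (hmem _ j).2 ⟨hl, hr⟩
end

section
/- Let A ⊆ ℂ be a finite set, let F ⊆ ℤ² be a convex relatively prime figure, and let w : ℤ² → ℂ be a function whose range is contained in A. Suppose there is a constant C ∈ ℂ such that ∑_{x ∈ F} w(x+t) = C for every t ∈ ℤ². Then w is fully periodic. -/
/-- The ring of integer Laurent polynomials in two variables. -/
abbrev LaurentZ2 : Type := AddMonoidAlgebra ℤ (ℤ × ℤ)

/-- The Laurent monomial with exponent `v`. -/
noncomputable def monom (v : ℤ × ℤ) : LaurentZ2 := AddMonoidAlgebra.single v 1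

lemma monom_add (u v : ℤ × ℤ) : monom (u + v) = monom u * monom v := by
  simp [monom, AddMonoidAlgebra.single_mul_single]

lemma monom_nsmul (n : ℕ) (v : ℤ × ℤ) : monom (n • v) = monom v ^ n := by
  simp [monom, AddMonoidAlgebra.single_pow]

/-- Translation by `v` as an endomorphism of the group of configurations. -/
def translation (v : ℤ × ℤ) : Module.End ℤ (ℤ × ℤ → ℂ) where
  toFun c x := c (x + v)
  map_add' _ _ := rfl
  map_smul' _ _ := rfl

/-- Laurent polynomials act on configurations, monomials acting by translation. -/
noncomputable def laurentAct : LaurentZ2 →ₐ[ℤ] Module.End ℤ (ℤ × ℤ → ℂ) :=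
  AddMonoidAlgebra.lift ℤ (Module.End ℤ (ℤ × ℤ → ℂ)) (ℤ × ℤ)
    { toFun := fun v => translation v.toAdd
      map_one' := by ext c x; simp [translation]
      map_mul' := fun u v => by
        ext c x
        simp [translation, add_assoc] }

lemma laurentAct_monom (v : ℤ × ℤ) (c : ℤ × ℤ → ℂ) (x : ℤ × ℤ) :
    laurentAct (monom v) c x = c (x + v) := by
  simp [laurentAct, monom, translation]

lemma laurentAct_sum_monom {ι : Type*} (s : Finset ι) (g : ι → ℤ × ℤ) (c : ℤ × ℤ → ℂ)
    (x : ℤ × ℤ) : laurentAct (∑ i ∈ s, monom (g i)) c x = ∑ i ∈ s, c (x + g i) := by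
  simp [map_sum, LinearMap.sum_apply, Finset.sum_apply, laurentAct_monom]

lemma laurentAct_mem (M : Submodule ℤ ℂ) {c : ℤ × ℤ → ℂ} (hc : ∀ x, c x ∈ M)
    (g : LaurentZ2) (x : ℤ × ℤ) : laurentAct g c x ∈ M := by
  induction g using AddMonoidAlgebra.induction_linear with
  | zero => simp
  | add f g hf hg => simpa using M.add_mem hf hg
  | single v a =>
    have : (AddMonoidAlgebra.single v a : LaurentZ2) = a • monom v := by simp [monom]
    rw [this, map_smul, LinearMap.smul_apply, Pi.smul_apply, laurentAct_monom]
    exact M.smul_mem a (hc _)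

lemma laurentAct_mul_eq_zero (g : LaurentZ2) {f : LaurentZ2} {c : ℤ × ℤ → ℂ}
    (h : laurentAct f c = 0) : laurentAct (g * f) c = 0 := by
  rw [map_mul, Module.End.mul_apply, h, map_zero]

lemma exists_sum_pow_prime_eq {R ι : Type*} [CommRing R] {p : ℕ} (hp : p.Prime)
    (s : Finset ι) (a : ι → R) : ∃ r, (∑ i ∈ s, a i) ^ p = ∑ i ∈ s, a i ^ p + p * r := by
  classical
  induction s using Finset.induction_on with
  | empty => exact ⟨0, by simp [hp.ne_zero]⟩
  | insert i s hi ih =>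
    obtain ⟨r, hr⟩ := ih
    obtain ⟨r', hr'⟩ := exists_add_pow_prime_eq hp (a i) (∑ i ∈ s, a i)
    refine ⟨r + a i * (∑ i ∈ s, a i) * r', ?_⟩
    rw [Finset.sum_insert hi, Finset.sum_insert hi, hr', hr]
    ring

/-- In a finitely generated subgroup of `ℂ`, a finite set of elements contains no nonzero
multiple of a large integer. -/
lemma exists_bound_of_eq_mul {M : Submodule ℤ ℂ} (hM : M.FG) {S : Set ℂ} (hS : S.Finite) :
    ∃ N : ℕ, ∀ p : ℕ, N < p → ∀ s ∈ S, ∀ m ∈ M, s = p * m → s = 0 := by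
  have key : ∀ s : ℂ, ∃ N : ℕ, ∀ p : ℕ, N < p → ∀ m ∈ M, s = p * m → s = 0 := by
    intro s
    have : Module.Finite ℤ M := Module.Finite.iff_fg.2 hM
    let b := Module.Free.chooseBasis ℤ M
    by_cases hs : s ∈ M
    · by_cases h0 : s = 0
      · exact ⟨0, fun _ _ _ _ _ => h0⟩
      have hne : (⟨s, hs⟩ : M) ≠ 0 := fun h => h0 (congrArg Subtype.val h)
      obtain ⟨i, hi⟩ : ∃ i, b.repr ⟨s, hs⟩ i ≠ 0 := by
        by_contra! h
        exact hne (b.repr.map_eq_zero_iff.1 (Finsupp.ext h))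
      refine ⟨(b.repr ⟨s, hs⟩ i).natAbs, fun p hp m hm hsm => ?_⟩
      have h1 : (⟨s, hs⟩ : M) = (p : ℤ) • ⟨m, hm⟩ := Subtype.ext (by simp [hsm])
      have h2 : b.repr ⟨s, hs⟩ i = (p : ℤ) * b.repr ⟨m, hm⟩ i := by
        rw [h1, map_smul, Finsupp.smul_apply, smul_eq_mul]
      have h3 : (p : ℤ) ∣ b.repr ⟨s, hs⟩ i := ⟨_, h2⟩
      have h4 := Nat.le_of_dvd (Int.natAbs_pos.2 hi) (Int.natCast_dvd.1 h3)
      omega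
    · refine ⟨0, fun p _ m hm hsm => absurd ?_ hs⟩
      rw [hsm]
      simpa using M.smul_mem (p : ℤ) hm
  choose N hN using key
  refine ⟨hS.toFinset.sup N, fun p hp s hs m hm h => hN s p (lt_of_le_of_lt ?_ hp) m hm h⟩
  exact Finset.le_sup (f := N) (hS.mem_toFinset.2 hs)

lemma exists_finite_sums {A : Set ℂ} (hA : A.Finite) {ι : Type*} (s : Finset ι) :
    {z : ℂ | ∃ a : ι → ℂ, (∀ i, a i ∈ A) ∧ z = ∑ i ∈ s, a i}.Finite := by
  classical
  induction s using Finset.induction_on with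
  | empty => exact (Set.finite_singleton (0 : ℂ)).subset (by rintro z ⟨a, -, rfl⟩; simp)
  | insert i s hi ih =>
    refine (Set.Finite.image2 (· + ·) hA ih).subset ?_
    rintro z ⟨a, ha, rfl⟩
    exact ⟨a i, ha i, _, ⟨a, ha, rfl⟩, by simp [Finset.sum_insert hi]⟩

/-- If the sums of `c` over all translates of `F` vanish and `c` has finite range, then so do the
sums over translates of many dilates of `F`. -/
lemma exists_dilate_annihilates {c : ℤ × ℤ → ℂ} (hc : (Set.range c).Finite)
    (F : Finset (ℤ × ℤ)) (hF : laurentAct (∑ v ∈ F, monom v) c = 0) :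
    ∃ r : ℕ, 0 < r ∧ ∀ i : ℕ, laurentAct (∑ v ∈ F, monom ((1 + i * r) • v)) c = 0 := by
  obtain ⟨N, hN⟩ := exists_bound_of_eq_mul (Submodule.fg_span (R := ℤ) hc)
    (exists_finite_sums hc F)
  have hmem : ∀ x, c x ∈ Submodule.span ℤ (Set.range c) :=
    fun x => Submodule.subset_span ⟨x, rfl⟩
  have key : ∀ n : ℕ, n ≠ 0 → (∀ p : ℕ, p.Prime → p ∣ n → N < p) →
      laurentAct (∑ v ∈ F, monom (n • v)) c = 0 := by
    intro n
    induction n using induction_on_primes with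
    | zero => exact fun h => absurd rfl h
    | one => intro _ _; simpa using hF
    | prime_mul p n hp ih =>
      intro hpn hdvd
      have hn := ih (right_ne_zero_of_mul hpn) fun q hq hqn => hdvd q hq (hqn.mul_left p)
      have hNp := hdvd p hp (dvd_mul_right p n)
      obtain ⟨r, hr⟩ := exists_sum_pow_prime_eq hp F fun v => monom (n • v)
      have hpow : laurentAct ((∑ v ∈ F, monom (n • v)) ^ p) c = 0 := by
        rw [← Nat.succ_pred_eq_of_pos hp.pos, pow_succ]
        exact laurentAct_mul_eq_zero _ hn
      have hr' : ∑ v ∈ F, monom ((p * n) • v)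
          = (∑ v ∈ F, monom (n • v)) ^ p + (p : ℤ) • (-r) := by
        rw [hr]
        simp only [mul_smul, monom_nsmul]
        simp
      ext x
      refine hN p hNp _ ⟨fun v => c (x + (p * n) • v), fun v => ⟨_, rfl⟩,
        laurentAct_sum_monom _ _ _ _⟩ _ (laurentAct_mem _ hmem (-r) x) ?_
      rw [hr', map_add, LinearMap.add_apply, hpow, map_smul]
      simp
  refine ⟨N.factorial, N.factorial_pos, fun i => key _ (by omega) fun p hp hpn => ?_⟩
  by_contra! h
  have h1 : p ∣ i * N.factorial := ((hp.dvd_factorial).2 h).mul_left i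
  exact hp.one_lt.ne' (Nat.dvd_one.1 ((Nat.dvd_add_left h1).1 hpn))

/-- A configuration of finite range annihilated by the indicator of `F` is annihilated by a
product of differences of monomials. -/
lemma exists_prod_sub_annihilates {c : ℤ × ℤ → ℂ} (hc : (Set.range c).Finite)
    (F : Finset (ℤ × ℤ)) (hF : laurentAct (∑ v ∈ F, monom v) c = 0)
    {v₀ : ℤ × ℤ} (hv₀ : v₀ ∈ F) :
    ∃ r : ℕ, 0 < r ∧ laurentAct (∏ v ∈ F.erase v₀, (monom (r • v₀) - monom (r • v))) c = 0 := by
  obtain ⟨r, hr, h⟩ := exists_dilate_annihilates hc F hF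
  refine ⟨r, hr, ?_⟩
  let P : Polynomial LaurentZ2 := ∏ v ∈ F.erase v₀, (Polynomial.X - Polynomial.C (monom (r • v)))
  have h1 : ∑ i ∈ Finset.range (P.natDegree + 1), P.coeff i * ∑ v ∈ F, monom ((1 + i * r) • v)
      = monom v₀ * P.eval (monom (r • v₀)) := by
    have h2 : ∀ v ∈ F, v ≠ v₀ → monom v * P.eval (monom (r • v)) = 0 := by
      intro v hv hne
      have : P.eval (monom (r • v)) = 0 := by
        rw [Polynomial.eval_prod]
        exact Finset.prod_eq_zero (Finset.mem_erase.2 ⟨hne, hv⟩) (by simp)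
      rw [this, mul_zero]
    rw [← Finset.sum_eq_single_of_mem v₀ hv₀ h2]
    simp only [Finset.mul_sum, Polynomial.eval_eq_sum_range]
    rw [Finset.sum_comm]
    refine Finset.sum_congr rfl fun v _ => Finset.sum_congr rfl fun i _ => ?_
    rw [add_smul, one_smul, monom_add, mul_smul, monom_nsmul i]
    ring
  have h3 : laurentAct (monom v₀ * P.eval (monom (r • v₀))) c = 0 := by
    rw [← h1, map_sum, LinearMap.sum_apply]
    exact Finset.sum_eq_zero fun i _ => laurentAct_mul_eq_zero _ (h i)
  have h4 := laurentAct_mul_eq_zero (monom (-v₀)) h3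
  rw [← mul_assoc, ← monom_add, neg_add_cancel] at h4
  have h5 : monom 0 = 1 := rfl
  rw [h5, one_mul, Polynomial.eval_prod] at h4
  simpa using h4

/-- `c` is invariant under translation by a full-rank lattice `N • ℤ²`. -/
def HasLatticePeriod (c : ℤ × ℤ → ℂ) : Prop :=
  ∃ N : ℕ, 0 < N ∧ ∀ v x, c (x + N • v) = c x

namespace HasLatticePeriod

lemma const (a : ℂ) : HasLatticePeriod fun _ => a := ⟨1, one_pos, fun _ _ => rfl⟩

lemma add {c d : ℤ × ℤ → ℂ} (hc : HasLatticePeriod c) (hd : HasLatticePeriod d) :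
    HasLatticePeriod fun x => c x + d x := by
  obtain ⟨N, hN, h⟩ := hc
  obtain ⟨K, hK, h'⟩ := hd
  refine ⟨N * K, Nat.mul_pos hN hK, fun v x => ?_⟩
  have h1 := h (K • v) x
  have h2 := h' (N • v) x
  rw [← mul_smul] at h1 h2
  rw [mul_comm K N] at h2
  simp only [h1, h2]

lemma sum {ι : Type*} (s : Finset ι) {c : ι → ℤ × ℤ → ℂ}
    (h : ∀ i ∈ s, HasLatticePeriod (c i)) : HasLatticePeriod fun x => ∑ i ∈ s, c i x := by
  classical
  induction s using Finset.induction_on with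
  | empty => simpa using const 0
  | insert i s hi ih =>
    simp only [Finset.sum_insert hi]
    exact (h i (Finset.mem_insert_self i s)).add
      (ih fun j hj => h j (Finset.mem_insert_of_mem hj))

lemma const_mul (a : ℂ) {c : ℤ × ℤ → ℂ} (hc : HasLatticePeriod c) :
    HasLatticePeriod fun x => a * c x := by
  obtain ⟨N, hN, h⟩ := hc
  exact ⟨N, hN, fun v x => by simp only [h]⟩

lemma fullyPeriodic {c : ℤ × ℤ → ℂ} (hc : HasLatticePeriod c) : FullyPeriodic c := by
  obtain ⟨N, hN, h⟩ := hc
  refine ⟨N • (1, 0), N • (0, 1), ?_, h _, h _⟩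
  rw [LinearIndependent.pair_iff]
  intro s t hst
  have hN' : (N : ℤ) ≠ 0 := by exact_mod_cast hN.ne'
  simpa [Prod.ext_iff, hN.ne'] using hst

end HasLatticePeriod

/-- A configuration of finite range whose difference along `u` is periodic is itself periodic along
a multiple of `u`. -/
lemma exists_period_of_sub {c : ℤ × ℤ → ℂ} (hc : (Set.range c).Finite) (u : ℤ × ℤ)
    (hd : HasLatticePeriod fun x => c (x + u) - c x) :
    ∃ N : ℕ, 0 < N ∧ ∀ x, c (x + N • u) = c x := by
  obtain ⟨N, hN, h⟩ := hd
  refine ⟨N, hN, fun x => ?_⟩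
  have hsum : ∀ (n : ℕ) y, c (y + n • u) - c y
      = ∑ i ∈ Finset.range n, (c (y + i • u + u) - c (y + i • u)) := by
    intro n y
    have := Finset.sum_range_sub (fun i : ℕ => c (y + i • u)) n
    simp only [zero_smul, add_zero] at this
    rw [← this]
    simp [add_smul, add_assoc]
  have hD : ∀ (j : ℕ), c (x + (j * N) • u + N • u) - c (x + (j * N) • u) = c (x + N • u) - c x := by
    intro j
    rw [hsum, hsum]
    refine Finset.sum_congr rfl fun i _ => ?_
    have hi : x + (j * N) • u + i • u = x + i • u + N • j • u := by
      rw [← mul_smul, mul_comm N j, add_right_comm]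
    rw [hi]
    exact h (j • u) (x + i • u)
  have hlin : ∀ j : ℕ, c (x + (j * N) • u) = c x + j * (c (x + N • u) - c x) := by
    intro j
    induction j with
    | zero => simp
    | succ j ih =>
      have := hD j
      rw [ih] at this
      rw [add_mul, one_mul, add_smul, ← add_assoc]
      push_cast
      linear_combination this
  have hninj : ¬ Function.Injective fun j : ℕ => c (x + (j * N) • u) := fun hinj =>
    Set.infinite_range_of_injective hinj
      (hc.subset (by rintro _ ⟨j, rfl⟩; exact ⟨_, rfl⟩))
  simp only [Function.Injective, not_forall] at hninj
  obtain ⟨i, j, hij, hne⟩ := hninj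
  rw [hlin, hlin] at hij
  have h0 : ((i : ℂ) - j) * (c (x + N • u) - c x) = 0 := by linear_combination hij
  rcases mul_eq_zero.1 h0 with h0 | h0
  · exact absurd (by exact_mod_cast sub_eq_zero.1 h0) hne
  · exact sub_eq_zero.1 h0

/-- A sequence satisfying a linear recurrence with `d + 1` terms and vanishing on an interval of
length `d` vanishes. -/
lemma eq_zero_of_recurrence {K : Finset ℤ} {b : ℤ → ℂ} {k₀ : ℤ} {d : ℕ}
    (hK : ∀ k ∈ K, b k ≠ 0 → k₀ ≤ k ∧ k ≤ k₀ + d) (h₀ : k₀ ∈ K) (h₁ : k₀ + d ∈ K)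
    (hb₀ : b k₀ ≠ 0) (hb₁ : b (k₀ + d) ≠ 0) {g : ℤ → ℂ}
    (hg : ∀ n, ∑ k ∈ K, b k * g (n + k) = 0) {m : ℤ}
    (hm : ∀ n, m ≤ n → n < m + d → g n = 0) (n : ℤ) : g n = 0 := by
  have key : ∀ j : ℕ, ∀ n, m - j ≤ n → n < m + d + j → g n = 0 := by
    intro j
    induction j with
    | zero => simpa using hm
    | succ j ih =>
      intro n hn1 hn2
      push_cast at hn1 hn2
      by_cases h1 : n = m + d + j
      · have h2 := hg (n - (k₀ + d))
        rw [Finset.sum_eq_single_of_mem _ h₁] at h2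
        · simpa [hb₁] using h2
        · intro k hk hne
          by_cases hbk : b k = 0
          · simp [hbk]
          · have := hK k hk hbk
            rw [ih _ (by omega) (by omega), mul_zero]
      by_cases h1' : n = m - (j + 1)
      · have h2 := hg (n - k₀)
        rw [Finset.sum_eq_single_of_mem _ h₀] at h2
        · simpa [hb₀] using h2
        · intro k hk hne
          by_cases hbk : b k = 0
          · simp [hbk]
          · have := hK k hk hbk
            rw [ih _ (by omega) (by omega), mul_zero]
      exact ih n (by omega) (by omega)
  exact key ((n - m).natAbs + 1) n (by omega) (by omega)

/-- Sequences with values in a fixed finite set satisfying a fixed nontrivial linear recurrence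
have a common period. -/
lemma exists_period_of_recurrence_s12 {B : Set ℂ} (hB : B.Finite) {K : Finset ℤ} {b : ℤ → ℂ}
    (hb : ∃ k ∈ K, b k ≠ 0) :
    ∃ N : ℕ, 0 < N ∧ ∀ h : ℤ → ℂ, (∀ n, h n ∈ B) →
      (∀ n, ∑ k ∈ K, b k * h (n + k) = 0) → ∀ n, h (n + N) = h n := by
  classical
  have : Finite B := hB
  have := Fintype.ofFinite B
  let S := K.filter fun k => b k ≠ 0
  have hS : S.Nonempty := by
    obtain ⟨k, hk, hbk⟩ := hb
    exact ⟨k, Finset.mem_filter.2 ⟨hk, hbk⟩⟩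
  obtain ⟨d, hd⟩ := Int.le.dest (S.min'_le _ (S.max'_mem hS))
  have h₀ := Finset.mem_filter.1 (S.min'_mem hS)
  have h₁ := Finset.mem_filter.1 (S.max'_mem hS)
  rw [← hd] at h₁
  have hK : ∀ k ∈ K, b k ≠ 0 → S.min' hS ≤ k ∧ k ≤ S.min' hS + d := fun k hk hbk => by
    have hkS : k ∈ S := Finset.mem_filter.2 ⟨hk, hbk⟩
    exact ⟨S.min'_le k hkS, hd ▸ S.le_max' k hkS⟩
  let L := Fintype.card (Fin d → B)
  refine ⟨L.factorial, L.factorial_pos, fun h hhB hrec => ?_⟩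
  obtain ⟨i, j, hij, hlt⟩ : ∃ i j : Fin (L + 1),
      (fun (e : Fin d) => (⟨h (i + e), hhB _⟩ : B)) = (fun (e : Fin d) => ⟨h (j + e), hhB _⟩)
        ∧ i < j := by
    obtain ⟨i, j, hne, hij⟩ := Fintype.exists_ne_map_eq_of_card_lt
      (fun (i : Fin (L + 1)) (e : Fin d) => (⟨h (i + e), hhB _⟩ : B)) (by simp [L])
    rcases lt_or_gt_of_ne hne with hlt | hlt
    · exact ⟨i, j, hij, hlt⟩
    · exact ⟨j, i, hij.symm, hlt⟩
  obtain ⟨p, hp⟩ := Nat.exists_eq_add_of_lt (Fin.lt_def.1 hlt)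
  have hper : ∀ n, h (n + (p + 1 : ℕ)) - h n = 0 := by
    refine eq_zero_of_recurrence (m := (i : ℕ)) (g := fun n => h (n + (p + 1 : ℕ)) - h n)
      hK h₀.1 h₁.1 h₀.2 h₁.2 (fun n => ?_) fun n hn1 hn2 => ?_
    · have h2 := hrec (n + (p + 1 : ℕ))
      simp only [mul_sub, Finset.sum_sub_distrib, hrec n, sub_zero]
      rw [← h2]
      exact Finset.sum_congr rfl fun k _ => by rw [add_right_comm]
    · obtain ⟨e, he⟩ := Int.le.dest hn1
      have h2 := congrArg Subtype.val (congrFun hij ⟨e, by omega⟩)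
      simp only at h2
      rw [sub_eq_zero, ← he, h2, hp]
      congr 1
      push_cast
      ring
  have hmul : ∀ (t : ℕ) n, h (n + ((p + 1) * t : ℕ)) = h n := by
    intro t
    induction t with
    | zero => simp
    | succ t ih =>
      intro n
      rw [← ih n, ← sub_eq_zero, ← hper (n + ((p + 1) * t : ℕ))]
      congr 2
      push_cast
      ring
  obtain ⟨t, ht⟩ := Nat.dvd_factorial (Nat.succ_pos p) (show p + 1 ≤ L by omega)
  intro n
  rw [ht]
  exact hmul t n

/-- A geometric sum over an interval of integers vanishes only if the ratio is a nontrivial root of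
unity of order dividing the length. -/
lemma pow_card_eq_one_of_sum_zpow_eq_zero {S : Finset ℤ} {ζ : ℂ} (hζ : ζ ≠ 0)
    (hS : ∀ a ∈ S, ∀ b ∈ S, ∀ m, a ≤ m → m ≤ b → m ∈ S) (h : ∑ a ∈ S, ζ ^ a = 0) :
    ζ ^ S.card = 1 := by
  rcases S.eq_empty_or_nonempty with rfl | hne
  · simp
  obtain ⟨n, hn⟩ := Int.le.dest (S.min'_le _ (S.max'_mem hne))
  have hSeq : S = (Finset.range (n + 1)).image fun i : ℕ => S.min' hne + i := by
    ext m
    simp only [Finset.mem_image, Finset.mem_range]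
    constructor
    · intro hm
      have h1 := S.min'_le m hm
      have h2 := S.le_max' m hm
      exact ⟨(m - S.min' hne).toNat, by omega, by omega⟩
    · rintro ⟨i, hi, rfl⟩
      exact hS _ (S.min'_mem hne) _ (S.max'_mem hne) _ (by omega) (by omega)
  have hinj : Function.Injective fun i : ℕ => S.min' hne + (i : ℤ) := fun i j hij => by
    simpa using hij
  have hcard : S.card = n + 1 := by
    rw [hSeq, Finset.card_image_of_injective _ hinj, Finset.card_range]
  rw [hSeq, Finset.sum_image fun i _ j _ hij => hinj hij] at h
  simp only [zpow_add₀ hζ, ← Finset.mul_sum, zpow_natCast] at h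
  have h1 := (mul_eq_zero.1 h).resolve_left (zpow_ne_zero _ hζ)
  have h2 := geom_sum_mul ζ (n + 1)
  rw [h1, zero_mul] at h2
  rw [hcard]
  exact (sub_eq_zero.1 h2.symm)

/-- An integer point of a line through two points of a convex figure and lying between them belongs
to the figure. -/
lemma IsConvexFigure.mem_of_between {F : Finset (ℤ × ℤ)} (hF : IsConvexFigure F)
    {u z : ℤ × ℤ} {a b m : ℤ} (ha : z + a • u ∈ F) (hb : z + b • u ∈ F) (ham : a ≤ m)
    (hmb : m ≤ b) : z + m • u ∈ F := by
  rcases eq_or_lt_of_le ham with rfl | ham'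
  · exact ha
  have hab : (0 : ℝ) < b - a := sub_pos.2 (by exact_mod_cast ham'.trans_le hmb)
  have ham₁ : (a : ℝ) ≤ m := by exact_mod_cast ham
  have hmb₁ : (m : ℝ) ≤ b := by exact_mod_cast hmb
  refine hF.2 _ (segment_subset_convexHull
    (Set.mem_image_of_mem _ (Finset.mem_coe.2 ha)) (Set.mem_image_of_mem _ (Finset.mem_coe.2 hb))
    ⟨(b - m) / (b - a), (m - a) / (b - a), div_nonneg (by linarith) hab.le, div_nonneg (by linarith) hab.le, ?_, ?_⟩)
  · field_simp
    ring
  · ext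
    · simp [toR2]
      field_simp
      ring
    · simp [toR2]
      field_simp
      ring

/-- Eigenfunctions of a primitive translation `u` with finite range and vanishing sums over
translates of a convex figure that is `u`-relatively prime are periodic. -/
lemma hasLatticePeriod_of_eigen {F : Finset (ℤ × ℤ)} (hconv : IsConvexFigure F)
    {u : ℤ × ℤ} (hrp : URelativelyPrime F u) (hu : IsCoprime u.1 u.2) {k : ℕ} (hk : 0 < k)
    {ζ : ℂ} (hζ : ζ ^ k = 1) {g : ℤ × ℤ → ℂ} (hg : (Set.range g).Finite)
    (hgu : ∀ x, g (x + u) = ζ * g x) (hsum : ∀ t, ∑ x ∈ F, g (x + t) = 0) :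
    HasLatticePeriod g := by
  classical
  obtain ⟨α, β, hαβ⟩ := hu
  have hζ0 : ζ ≠ 0 := by
    rintro rfl
    simp [hk.ne'] at hζ
  let s : ℤ × ℤ := (β, -α)
  let lvl : ℤ × ℤ → ℤ := fun x => u.2 * x.1 - u.1 * x.2
  let pos : ℤ × ℤ → ℤ := fun x => α * x.1 + β * x.2
  have hdecomp : ∀ x, x = lvl x • s + pos x • u := by
    intro x
    ext
    · simp only [lvl, pos, s, Prod.fst_add, Prod.smul_fst, smul_eq_mul]
      linear_combination (-x.1) * hαβ
    · simp only [lvl, pos, s, Prod.snd_add, Prod.smul_snd, smul_eq_mul]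
      linear_combination (-x.2) * hαβ
  have hlvl : ∀ a b : ℤ, lvl (a • s + b • u) = a := by
    intro a b
    simp only [lvl, s, Prod.fst_add, Prod.smul_fst, smul_eq_mul, Prod.snd_add, Prod.smul_snd]
    linear_combination a * hαβ
  have hpos : ∀ a b : ℤ, pos (a • s + b • u) = b := by
    intro a b
    simp only [pos, s, Prod.fst_add, Prod.smul_fst, smul_eq_mul, Prod.snd_add, Prod.smul_snd]
    linear_combination b * hαβ
  have hgz : ∀ (m : ℤ) x, g (x + m • u) = ζ ^ m * g x := by
    intro m
    induction m using Int.induction_on with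
    | zero => simp
    | succ i ih =>
      intro x
      rw [add_smul, one_smul, ← add_assoc, hgu, ih, zpow_add_one₀ hζ0]
      ring
    | pred i ih =>
      intro x
      have h1 := hgu (x + (-(i : ℤ) - 1) • u)
      rw [add_assoc, sub_smul, one_smul, sub_add_cancel, ih] at h1
      rw [sub_smul, one_smul, zpow_sub_one₀ hζ0, mul_right_comm, h1]
      field_simp
  let b : ℤ → ℂ := fun κ => ∑ x ∈ F with lvl x = κ, ζ ^ pos x
  have hrec : ∀ t, ∑ κ ∈ F.image lvl, b κ * g (t + κ • s) = 0 := by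
    intro t
    rw [← hsum t, ← Finset.sum_fiberwise_of_maps_to fun x hx => Finset.mem_image_of_mem lvl hx]
    refine Finset.sum_congr rfl fun κ _ => ?_
    rw [Finset.sum_mul]
    refine Finset.sum_congr rfl fun x hx => ?_
    rw [← (Finset.mem_filter.1 hx).2, ← hgz]
    congr 1
    conv_rhs => rw [hdecomp x]
    abel
  have hb : ∃ κ ∈ F.image lvl, b κ ≠ 0 := by
    by_contra! hb0
    have hord : orderOf ζ ∣ 1 := by
      rw [← show _ = 1 from hrp]
      refine Finset.dvd_gcd fun κ hκ => orderOf_dvd_of_pow_eq_one ?_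
      have hinj : Set.InjOn pos (F.filter fun x => lvl x = κ) := by
        intro x hx y hy hxy
        rw [Finset.mem_coe, Finset.mem_filter] at hx hy
        rw [hdecomp x, hdecomp y, hxy, hx.2, hy.2]
      have h1 := hb0 κ hκ
      simp only [b] at h1
      rw [← Finset.sum_image (f := fun a : ℤ => ζ ^ a) hinj] at h1
      have h2 := pow_card_eq_one_of_sum_zpow_eq_zero hζ0 ?_ h1
      · rwa [Finset.card_image_of_injOn hinj] at h2
      · have hmem : ∀ a, a ∈ (F.filter fun x => lvl x = κ).image pos ↔ κ • s + a • u ∈ F := by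
          intro a
          simp only [Finset.mem_image, Finset.mem_filter]
          constructor
          · rintro ⟨x, ⟨hx, rfl⟩, rfl⟩
            rwa [← hdecomp x]
          · intro h
            exact ⟨_, ⟨h, hlvl _ _⟩, hpos _ _⟩
        intro a ha c hc m
        rw [hmem] at ha hc ⊢
        exact hconv.mem_of_between ha hc
    have hζ1 : ζ = 1 := orderOf_eq_one_iff.1 (Nat.dvd_one.1 hord)
    obtain ⟨x, hx⟩ := hconv.1
    have h1 := hb0 (lvl x) (Finset.mem_image_of_mem _ hx)
    simp only [b, hζ1, one_zpow, Finset.sum_const, nsmul_eq_mul, mul_one, Nat.cast_eq_zero,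
      Finset.card_eq_zero] at h1
    exact Finset.notMem_empty x (h1 ▸ Finset.mem_filter.2 ⟨hx, rfl⟩)
  obtain ⟨N, hN, hper⟩ := exists_period_of_recurrence_s12 hg hb
  have hs : ∀ x, g (x + (N : ℤ) • s) = g x := by
    intro x
    have := hper (fun n => g (x + n • s)) (fun n => ⟨_, rfl⟩)
      (fun n => by simpa only [add_smul, add_assoc] using hrec (x + n • s)) 0
    simpa using this
  have hsm : ∀ (m : ℤ) x, g (x + m • (N : ℤ) • s) = g x := by
    intro m
    induction m using Int.induction_on with
    | zero => simp
    | succ i ih => intro x; rw [add_smul, one_smul, ← add_assoc, hs, ih]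
    | pred i ih => intro x; rw [← hs, sub_smul, one_smul, add_assoc, sub_add_cancel, ih]
  refine ⟨N * k, Nat.mul_pos hN hk, fun v x => ?_⟩
  have hv : x + (N * k) • v
      = x + (k * lvl v) • (N : ℤ) • s + ((k : ℤ) * (N * pos v)) • u := by
    conv_lhs => rw [hdecomp v]
    module
  rw [hv, hgz, hsm, zpow_mul, zpow_natCast, hζ, one_zpow, one_mul]

lemma finite_range_sum {ι : Type*} (s : Finset ι) {c : ι → ℤ × ℤ → ℂ}
    (h : ∀ i ∈ s, (Set.range (c i)).Finite) :
    (Set.range fun x => ∑ i ∈ s, c i x).Finite := by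
  classical
  induction s using Finset.induction_on with
  | empty => simp
  | insert i s hi ih =>
    refine (Set.Finite.image2 (· + ·) (h i (Finset.mem_insert_self i s))
      (ih fun j hj => h j (Finset.mem_insert_of_mem hj))).subset ?_
    rintro _ ⟨x, rfl⟩
    exact ⟨_, ⟨x, rfl⟩, _, ⟨x, rfl⟩, by simp [Finset.sum_insert hi]⟩

/-- The result for configurations of finite range that have at least one nonzero period. -/
lemma hasLatticePeriod_of_period {F : Finset (ℤ × ℤ)} (hconv : IsConvexFigure F)
    (hrp : RelativelyPrime F) {c : ℤ × ℤ → ℂ} (hc : (Set.range c).Finite)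
    (hsum : ∀ t, ∑ x ∈ F, c (x + t) = 0) {v : ℤ × ℤ} (hv : v ≠ 0)
    (hper : ∀ x, c (x + v) = c x) : HasLatticePeriod c := by
  obtain ⟨k, u, hk, hu, rfl⟩ : ∃ (k : ℕ) (u : ℤ × ℤ), 0 < k ∧ IsCoprime u.1 u.2 ∧ v = k • u := by
    have hpos : 0 < Int.gcd v.1 v.2 := by
      rw [Int.gcd_pos_iff]
      by_contra! h
      exact hv (Prod.ext h.1 h.2)
    obtain ⟨a, b, hab, h1, h2⟩ := Int.exists_gcd_one hpos
    exact ⟨Int.gcd v.1 v.2, (a, b), hpos, Int.isCoprime_iff_gcd_eq_one.2 hab,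
      Prod.ext (by simpa [mul_comm] using h1) (by simpa [mul_comm] using h2)⟩
  have hu0 : u ≠ 0 := by
    rintro rfl
    simp at hv
  have hω := Complex.isPrimitiveRoot_exp k hk.ne'
  set ω := Complex.exp (2 * Real.pi * Complex.I / k)
  have hω0 : ω ≠ 0 := hω.ne_zero hk.ne'
  let e : ℕ → ℤ × ℤ → ℂ := fun i x => ∑ j ∈ Finset.range k, (ω ^ i)⁻¹ ^ j * c (x + j • u)
  have he : ∀ i, HasLatticePeriod (e i) := by
    intro i
    have hωi : (ω ^ i) ^ k = 1 := by rw [← pow_mul, mul_comm, pow_mul, hω.pow_eq_one, one_pow]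
    have hωi0 : ω ^ i ≠ 0 := pow_ne_zero _ hω0
    refine hasLatticePeriod_of_eigen hconv (hrp u hu0) hu hk hωi ?_ ?_ ?_
    · refine finite_range_sum _ fun j _ => (hc.image fun z => (ω ^ i)⁻¹ ^ j * z).subset ?_
      rintro _ ⟨x, rfl⟩
      exact ⟨_, ⟨_, rfl⟩, rfl⟩
    · intro x
      have h1 : ∀ j ∈ Finset.range k, (ω ^ i)⁻¹ ^ j * c (x + u + j • u)
          = ω ^ i * ((ω ^ i)⁻¹ ^ (j + 1) * c (x + (j + 1) • u)) := by
        intro j _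
        rw [pow_succ, add_smul, one_smul, add_assoc, add_comm u]
        field_simp
      simp only [e]
      rw [Finset.sum_congr rfl h1, ← Finset.mul_sum]
      congr 1
      have h2 := Finset.sum_range_succ' (fun j => (ω ^ i)⁻¹ ^ j * c (x + j • u)) k
      rw [Finset.sum_range_succ] at h2
      simp only [inv_pow, hωi, hper, zero_smul, add_zero, pow_zero, inv_one] at h2 ⊢
      exact (add_right_cancel h2).symm
    · intro t
      simp only [e]
      rw [Finset.sum_comm]
      refine Finset.sum_eq_zero fun j _ => ?_
      rw [← Finset.mul_sum]
      simp only [add_assoc, hsum, mul_zero]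
  have hsumE : c = fun x => (k : ℂ)⁻¹ * ∑ i ∈ Finset.range k, e i x := by
    ext x
    have h1 : ∑ i ∈ Finset.range k, e i x = k * c x := by
      simp only [e]
      rw [Finset.sum_comm]
      have h2 : ∀ j ∈ Finset.range k, j ≠ 0 →
          ∑ i ∈ Finset.range k, (ω ^ i)⁻¹ ^ j * c (x + j • u) = 0 := by
        intro j hj hj0
        have h3 : ω⁻¹ ^ j ≠ 1 := by
          rw [inv_pow, Ne, inv_eq_one]
          exact hω.pow_ne_one_of_pos_of_lt hj0 (Finset.mem_range.1 hj)
        have h4 := geom_sum_mul (ω⁻¹ ^ j) k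
        rw [← pow_mul, mul_comm j k, pow_mul, inv_pow ω k, hω.pow_eq_one, inv_one, one_pow,
          sub_self] at h4
        have h5 := (mul_eq_zero.1 h4).resolve_right (sub_ne_zero.2 h3)
        rw [← Finset.sum_mul, ← zero_mul (c (x + j • u)), ← h5]
        congr 1
        refine Finset.sum_congr rfl fun i _ => ?_
        rw [← inv_pow, ← pow_mul, ← pow_mul, mul_comm]
      rw [Finset.sum_eq_single_of_mem 0 (Finset.mem_range.2 hk) h2]
      simp
    have hk' : (k : ℂ) ≠ 0 := by exact_mod_cast hk.ne'
    rw [h1]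
    field_simp
  rw [hsumE]
  exact (HasLatticePeriod.sum _ fun i _ => he i).const_mul _

lemma hasLatticePeriod_of_prod_annihilates {F : Finset (ℤ × ℤ)} (hconv : IsConvexFigure F)
    (hrp : RelativelyPrime F) {v₀ : ℤ × ℤ} {r : ℕ} (hr : 0 < r) (S : Finset (ℤ × ℤ))
    (hS : v₀ ∉ S) {c : ℤ × ℤ → ℂ} (hc : (Set.range c).Finite)
    (hsum : ∀ t, ∑ x ∈ F, c (x + t) = 0)
    (hann : laurentAct (∏ v ∈ S, (monom (r • v₀) - monom (r • v))) c = 0) :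
    HasLatticePeriod c := by
  classical
  induction S using Finset.induction_on generalizing c with
  | empty =>
    have : c = 0 := by simpa using hann
    rw [this]
    exact HasLatticePeriod.const 0
  | insert v S hv ih =>
    rw [Finset.mem_insert, not_or] at hS
    have hdiff : HasLatticePeriod fun x => c (x + r • v₀) - c (x + r • v) := by
      refine ih hS.2 ?_ ?_ ?_
      · refine (Set.Finite.image2 (· - ·) hc hc).subset ?_
        rintro _ ⟨x, rfl⟩
        exact ⟨_, ⟨_, rfl⟩, _, ⟨_, rfl⟩, rfl⟩
      · intro t
        simp only [Finset.sum_sub_distrib, add_assoc, hsum, sub_zero]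
      · rw [Finset.prod_insert hv, mul_comm, map_mul, Module.End.mul_apply] at hann
        rw [← hann]
        congr 1
        ext x
        simp [laurentAct_monom]
    obtain ⟨N, hN, h⟩ := hdiff
    obtain ⟨K, hK, hper⟩ := exists_period_of_sub hc (r • (v₀ - v))
      ⟨N, hN, fun y x => by
        have h1 : ∀ z, z + r • (v₀ - v) = z - r • v + r • v₀ := fun z => by module
        have h2 : x + N • y - r • v = x - r • v + N • y := by abel
        have h3 := h y (x - r • v)
        simp only [← h2, ← h1, sub_add_cancel] at h3
        exact h3⟩
    refine hasLatticePeriod_of_period hconv hrp hc hsum (v := K • r • (v₀ - v)) ?_ hper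
    exact smul_ne_zero hK.ne' (smul_ne_zero hr.ne' (sub_ne_zero.2 hS.1))

/-- Let A ⊆ ℂ be a finite set, F ⊆ ℤ² a convex relatively prime figure, and
w : ℤ² → ℂ a function with range contained in A such that ∑_{x ∈ F} w(x+t) = C for every
t ∈ ℤ² and some constant C. Then w is fully periodic. -/
theorem stmt12 (A : Finset ℂ) (F : Finset (ℤ × ℤ))
    (hconv : IsConvexFigure F) (hrp : RelativelyPrime F)
    (w : ℤ × ℤ → ℂ) (hwA : ∀ x : ℤ × ℤ, w x ∈ A)
    (C : ℂ) (hsum : ∀ t : ℤ × ℤ, ∑ x ∈ F, w (x + t) = C) :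
    FullyPeriodic w := by
  obtain ⟨v₀, hv₀⟩ := hconv.1
  have hF0 : (F.card : ℂ) ≠ 0 := by exact_mod_cast (Finset.card_pos.2 ⟨v₀, hv₀⟩).ne'
  let c : ℤ × ℤ → ℂ := fun x => w x - C / F.card
  have hc : (Set.range c).Finite := by
    refine (A.finite_toSet.image fun z => z - C / F.card).subset ?_
    rintro _ ⟨x, rfl⟩
    exact ⟨_, hwA x, rfl⟩
  have hcsum : ∀ t, ∑ x ∈ F, c (x + t) = 0 := by
    intro t
    simp only [c, Finset.sum_sub_distrib, hsum, Finset.sum_const, nsmul_eq_mul]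
    field_simp
    ring
  have hcF : laurentAct (∑ v ∈ F, monom v) c = 0 := by
    ext t
    rw [laurentAct_sum_monom]
    simpa only [add_comm, Pi.zero_apply] using hcsum t
  obtain ⟨r, hr, hann⟩ := exists_prod_sub_annihilates hc F hcF hv₀
  have hper := hasLatticePeriod_of_prod_annihilates hconv hrp hr _ (Finset.notMem_erase v₀ F)
    hc hcsum hann
  have hw : w = fun x => c x + C / F.card := by
    ext x
    simp [c]
  rw [hw]
  exact (hper.add (HasLatticePeriod.const _)).fullyPeriodic
end
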